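/- arXiv:1002.3893 — 2 statements merged into one kernel-verified Lean document; each statement's English description precedes it below -/
import Mathlib

section
/- Consider n unit-demand agents, m services, independent values v_ij ∼ F_ij (Borel distributions on ℝ_{≥0} with finite mean), and feasibility given by a fixed matroid N on [n]×[m] intersected with the unit-demand constraint. The expected revenue of every lottery-based mechanism for the multi-agent instance is at most 5 times the supremum of expected revenue over all dominant-strategy incentive compatible, individually rational deterministic mechanisms for the copies instance. -/
open MeasureTheory

/-- A matroid on a finite ground set `E`, given by its family of independent
(finite) sets, satisfying heredity and augmentation. -/
structure FinMatroid (E : Type*) [DecidableEq E] [Fintype E] where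
  Indep : Finset E → Prop
  subset_indep : ∀ ⦃A B : Finset E⦄, Indep A → B ⊆ A → Indep B
  augment : ∀ ⦃A B : Finset E⦄, Indep A → Indep B → B.card < A.card →
    ∃ e ∈ A \ B, Indep (insert e B)

/-- `S` is feasible: independent in the matroid `N` and each agent appears in
at most one pair of `S` (the unit-demand constraint). -/
def FeasibleSet {n m : ℕ} (N : FinMatroid (Fin n × Fin m))
    (S : Finset (Fin n × Fin m)) : Prop :=
  N.Indep S ∧ ∀ i : Fin n, (S.filter fun e => e.1 = i).card ≤ 1

/-- `feasRank N S` is the maximum cardinality of a feasible subset of `S`. -/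
noncomputable def feasRank {n m : ℕ} (N : FinMatroid (Fin n × Fin m))
    (S : Finset (Fin n × Fin m)) : ℕ :=
  sSup {c : ℕ | ∃ M : Finset (Fin n × Fin m), M ⊆ S ∧ FeasibleSet N M ∧ M.card = c}

/-- The product distribution of the independent values `v i j ∼ F i j` on
valuation matrices. -/
noncomputable def valMeasure {n m : ℕ} (F : Fin n → Fin m → Measure ℝ) :
    Measure (Fin n → Fin m → ℝ) :=
  Measure.pi fun i => Measure.pi fun j => F i j

/-- The valuation matrix obtained from `v` by changing entry `(i, j)` to `c`. -/
noncomputable def updateEntry {n m : ℕ} (v : Fin n → Fin m → ℝ) (i : Fin n)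
    (j : Fin m) (c : ℝ) : Fin n → Fin m → ℝ :=
  Function.update v i (Function.update (v i) j c)

/-- A dominant-strategy IC, IR deterministic mechanism for the copies
instance: `X v` is the feasible set of served pseudo-agents and
`pay v (i, j) ≥ 0` is the payment of pseudo-agent `(i, j)`. -/
structure IsCopiesMech (n m : ℕ) (N : FinMatroid (Fin n × Fin m))
    (X : (Fin n → Fin m → ℝ) → Finset (Fin n × Fin m))
    (pay : (Fin n → Fin m → ℝ) → Fin n × Fin m → ℝ) : Prop where
  feas : ∀ v, FeasibleSet N (X v)
  measX : ∀ S : Finset (Fin n × Fin m), MeasurableSet {v | X v = S}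
  measPay : ∀ e : Fin n × Fin m, Measurable fun v => pay v e
  pay_nonneg : ∀ v e, 0 ≤ pay v e
  ic : ∀ v : Fin n → Fin m → ℝ, (∀ i j, 0 ≤ v i j) →
    ∀ (i : Fin n) (j : Fin m) (c : ℝ), 0 ≤ c →
      (if (i, j) ∈ X (updateEntry v i j c) then v i j else 0)
          - pay (updateEntry v i j c) (i, j)
        ≤ (if (i, j) ∈ X v then v i j else 0) - pay v (i, j)
  ir : ∀ v : Fin n → Fin m → ℝ, (∀ i j, 0 ≤ v i j) → ∀ e : Fin n × Fin m,
    0 ≤ (if e ∈ X v then v e.1 e.2 else 0) - pay v e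

/-- Expected revenue of a mechanism for the copies instance. -/
noncomputable def copiesRevenue {n m : ℕ} (F : Fin n → Fin m → Measure ℝ)
    (pay : (Fin n → Fin m → ℝ) → Fin n × Fin m → ℝ) : ℝ :=
  ∫ v, ∑ e : Fin n × Fin m, pay v e ∂(valMeasure F)

/-- A lottery over `m` services: allocation probabilities `q` with `q j ≥ 0`,
`∑ j, q j ≤ 1`, and a price `p ≥ 0`. -/
structure Lottery (m : ℕ) where
  q : Fin m → ℝ
  p : ℝ
  q_nonneg : ∀ j, 0 ≤ q j
  q_sum_le_one : ∑ j, q j ≤ 1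
  p_nonneg : 0 ≤ p

/-- The (expected) utility of lottery `ℓ` at valuation `v`. -/
def Lottery.util {m : ℕ} (ℓ : Lottery m) (v : Fin m → ℝ) : ℝ :=
  (∑ j, ℓ.q j * v j) - ℓ.p

/-- A lottery-based mechanism for the multi-agent instance: agent `i` facing
the other agents' values is offered the menu `menu i v` (which does not depend
on `v i`), and purchases the utility-maximizing lottery, whose probability
vector and price at profile `v` are `q v i` and `p v i`; the purchase
probabilities satisfy the feasibility constraint
`∑_{(i,j) ∈ S} q v i j ≤ r S`. -/
structure IsLotteryMech (n m : ℕ) (N : FinMatroid (Fin n × Fin m))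
    (menu : Fin n → (Fin n → Fin m → ℝ) → Set (Lottery m))
    (q : (Fin n → Fin m → ℝ) → Fin n → Fin m → ℝ)
    (p : (Fin n → Fin m → ℝ) → Fin n → ℝ) : Prop where
  menu_indep : ∀ (i : Fin n) (v w : Fin n → Fin m → ℝ),
    (∀ i', i' ≠ i → v i' = w i') → menu i v = menu i w
  measQ : ∀ i j, Measurable fun v => q v i j
  measP : ∀ i, Measurable fun v => p v i
  choice : ∀ v : Fin n → Fin m → ℝ, (∀ i j, 0 ≤ v i j) → ∀ i : Fin n,
    (∃ ℓ ∈ menu i v, ℓ.q = q v i ∧ ℓ.p = p v i ∧ 0 ≤ ℓ.util (v i) ∧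
      ∀ ℓ' ∈ menu i v, ℓ'.util (v i) ≤ ℓ.util (v i)) ∨
    (q v i = 0 ∧ p v i = 0 ∧ ∀ ℓ ∈ menu i v, ℓ.util (v i) ≤ 0)
  feas : ∀ (v : Fin n → Fin m → ℝ) (S : Finset (Fin n × Fin m)),
    ∑ e ∈ S, q v e.1 e.2 ≤ (feasRank N S : ℝ)

/-- Expected revenue of a lottery-based multi-agent mechanism. -/
noncomputable def lotteryMechRevenue {n m : ℕ} (F : Fin n → Fin m → Measure ℝ)
    (p : (Fin n → Fin m → ℝ) → Fin n → ℝ) : ℝ :=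
  ∫ v, ∑ i : Fin n, p v i ∂(valMeasure F)

section FinMatroid

variable {E : Type*} [DecidableEq E] [Fintype E]

lemma FinMatroid.exists_extension (N : FinMatroid E) {A B : Finset E} (hA : N.Indep A)
    (hB : N.Indep B) (hcard : B.card ≤ A.card) :
    ∃ C, B ⊆ C ∧ C ⊆ A ∪ B ∧ N.Indep C ∧ C.card = A.card := by
  obtain ⟨k, hk⟩ := Nat.exists_eq_add_of_le hcard
  induction k generalizing B with
  | zero => exact ⟨B, subset_rfl, Finset.subset_union_right, hB, by omega⟩
  | succ k ih =>
    obtain ⟨e, he, hind⟩ := N.augment hA hB (by omega)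
    rw [Finset.mem_sdiff] at he
    have hc : (insert e B).card = B.card + 1 := Finset.card_insert_of_notMem he.2
    obtain ⟨C, h1, h2, h3, h4⟩ := ih hind (by omega) (by omega)
    refine ⟨C, (Finset.subset_insert _ _).trans h1, h2.trans ?_, h3, h4⟩
    intro x hx
    simp only [Finset.mem_union, Finset.mem_insert] at hx ⊢
    rcases hx with h | rfl | h
    · exact Or.inl h
    · exact Or.inl he.1
    · exact Or.inr h

/-- If `f` can be exchanged into `A` neither for free nor for a single element of `A \ K`,
then `K` spans `f`. -/
lemma FinMatroid.not_indep_insert_of_exchange (N : FinMatroid E) {A K : Finset E} {f : E}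
    (hA : N.Indep A) (hK : K ⊆ A) (hf : f ∉ A) (hfA : ¬ N.Indep (insert f A))
    (hex : ∀ e ∈ A \ K, ¬ N.Indep (insert f (A.erase e))) : ¬ N.Indep (insert f K) := by
  intro hfK
  have hfK' : f ∉ K := fun h => hf (hK h)
  by_cases hKA : K = A
  · exact hfA (hKA ▸ hfK)
  have hlt : K.card < A.card := Finset.card_lt_card (Finset.ssubset_iff_subset_ne.2 ⟨hK, hKA⟩)
  obtain ⟨C, h1, h2, h3, h4⟩ := N.exists_extension hA hfK
    (by rw [Finset.card_insert_of_notMem hfK']; omega)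
  have hfC : f ∈ C := h1 (Finset.mem_insert_self _ _)
  have hCA : C.erase f ⊆ A := by
    intro x hx
    rw [Finset.mem_erase] at hx
    have := h2 hx.2
    simp only [Finset.mem_union, Finset.mem_insert] at this
    rcases this with h | h | h
    · exact h
    · exact absurd h hx.1
    · exact hK h
  have hcard : (C.erase f).card + 1 = A.card := by
    rw [Finset.card_erase_add_one hfC, h4]
  have hdiff : (A \ C.erase f).card = 1 := by
    rw [Finset.card_sdiff_of_subset hCA]; omega
  obtain ⟨e, he⟩ := Finset.card_eq_one.1 hdiff
  have heA : e ∈ A \ C.erase f := he ▸ Finset.mem_singleton_self e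
  rw [Finset.mem_sdiff] at heA
  refine hex e (Finset.mem_sdiff.2 ⟨heA.1, fun hk => heA.2 (Finset.mem_erase.2
    ⟨fun h => hfK' (h ▸ hk), h1 (Finset.mem_insert_of_mem hk)⟩)⟩) ?_
  refine N.subset_indep h3 ?_
  intro x hx
  rw [Finset.mem_insert, Finset.mem_erase] at hx
  rcases hx with rfl | ⟨hxe, hxA⟩
  · exact hfC
  · by_contra hxC
    have : x ∈ A \ C.erase f :=
      Finset.mem_sdiff.2 ⟨hxA, fun h => hxC (Finset.mem_of_mem_erase h)⟩
    rw [he, Finset.mem_singleton] at this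
    exact hxe this

lemma FinMatroid.card_le_of_forall_not_indep_insert (N : FinMatroid E) {B K : Finset E}
    (hB : N.Indep B) (hK : N.Indep K) (h : ∀ f ∈ B, ¬ N.Indep (insert f K)) :
    B.card ≤ K.card := by
  by_contra! hlt
  obtain ⟨e, he, hind⟩ := N.augment hB hK hlt
  exact h e (Finset.mem_sdiff.1 he).1 hind

end FinMatroid

section Valuations

variable {n m : ℕ}

lemma updateEntry_apply (v : Fin n → Fin m → ℝ) (i : Fin n) (j : Fin m) (c : ℝ)
    (e : Fin n × Fin m) :
    updateEntry v i j c e.1 e.2 = if e = (i, j) then c else v e.1 e.2 := by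
  obtain ⟨a, b⟩ := e
  by_cases ha : a = i
  · subst ha
    by_cases hb : b = j
    · subst hb; simp [updateEntry]
    · simp [updateEntry, hb]
  · simp [updateEntry, ha]

lemma updateEntry_updateEntry (v : Fin n → Fin m → ℝ) (i : Fin n) (j : Fin m) (c d : ℝ) :
    updateEntry (updateEntry v i j c) i j d = updateEntry v i j d := by
  simp [updateEntry]

lemma updateEntry_self (v : Fin n → Fin m → ℝ) (i : Fin n) (j : Fin m) :
    updateEntry v i j (v i j) = v := by
  simp [updateEntry]

lemma updateEntry_nonneg {v : Fin n → Fin m → ℝ} (hv : ∀ i j, 0 ≤ v i j) (i : Fin n) (j : Fin m)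
    {c : ℝ} (hc : 0 ≤ c) (i' : Fin n) (j' : Fin m) : 0 ≤ updateEntry v i j c i' j' := by
  rw [updateEntry_apply v i j c (i', j')]
  split_ifs
  exacts [hc, hv _ _]

lemma measurable_updateEntry (i : Fin n) (j : Fin m) (c : ℝ) :
    Measurable fun v : Fin n → Fin m → ℝ => updateEntry v i j c := by
  refine measurable_pi_iff.2 fun a => measurable_pi_iff.2 fun b => ?_
  simp only [fun v : Fin n → Fin m → ℝ => updateEntry_apply v i j c (a, b)]
  split_ifs
  · exact measurable_const
  · fun_prop

/-- Pairs are ranked by value, with ties broken lexicographically. -/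
def rankKey (v : Fin n → Fin m → ℝ) (e : Fin n × Fin m) : ℝ ×ₗ (Fin n ×ₗ Fin m) :=
  toLex (v e.1 e.2, toLex e)

lemma rankKey_lt_iff {v : Fin n → Fin m → ℝ} {e f : Fin n × Fin m} :
    rankKey v e < rankKey v f ↔
      v e.1 e.2 < v f.1 f.2 ∨ v e.1 e.2 = v f.1 f.2 ∧ toLex e < toLex f :=
  Prod.Lex.toLex_lt_toLex

lemma rankKey_injective (v : Fin n → Fin m → ℝ) : Function.Injective (rankKey v) := by
  intro e f h
  have := congrArg (fun x => (ofLex x).2) h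
  simpa [rankKey] using this

lemma le_of_rankKey_lt {v : Fin n → Fin m → ℝ} {e f : Fin n × Fin m}
    (h : rankKey v e < rankKey v f) : v e.1 e.2 ≤ v f.1 f.2 := by
  rcases rankKey_lt_iff.1 h with h | h
  exacts [h.le, h.1.le]

lemma rankKey_updateEntry_of_ne (v : Fin n → Fin m → ℝ) (i : Fin n) (j : Fin m) (c : ℝ)
    {f : Fin n × Fin m} (hf : f ≠ (i, j)) : rankKey (updateEntry v i j c) f = rankKey v f := by
  simp [rankKey, updateEntry_apply, hf]

lemma rankKey_updateEntry_mono (v : Fin n → Fin m → ℝ) (i : Fin n) (j : Fin m) {c d : ℝ}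
    (hcd : c ≤ d) :
    rankKey (updateEntry v i j c) (i, j) ≤ rankKey (updateEntry v i j d) (i, j) := by
  have h : ∀ x, updateEntry v i j x i j = x := fun x => by simp [updateEntry]
  simp only [rankKey, Prod.Lex.toLex_le_toLex, h]
  exact hcd.lt_or_eq.imp_right fun h => ⟨h, by simp⟩

lemma rankKey_induction (v : Fin n → Fin m → ℝ) {P : Fin n × Fin m → Prop}
    (h : ∀ e, (∀ f, rankKey v e < rankKey v f → P f) → P e) (e : Fin n × Fin m) : P e := by
  have wf : WellFounded fun f e : Fin n × Fin m => rankKey v e < rankKey v f := by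
    have : IsTrans (Fin n × Fin m) fun f e => rankKey v e < rankKey v f :=
      ⟨fun _ _ _ h1 h2 => h2.trans h1⟩
    have : Std.Irrefl fun f e : Fin n × Fin m => rankKey v e < rankKey v f :=
      ⟨fun _ => lt_irrefl _⟩
    exact Finite.wellFounded_of_trans_of_irrefl _
  exact wf.induction e h

end Valuations

section Greedy

variable {n m : ℕ}

/-- `S` is independent in `N` and each agent appears in at most two pairs of `S`. -/
def TwoDemandIndep (N : FinMatroid (Fin n × Fin m)) (S : Finset (Fin n × Fin m)) : Prop :=
  N.Indep S ∧ ∀ i : Fin n, (S.filter fun e => e.1 = i).card ≤ 2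

lemma TwoDemandIndep.mono {N : FinMatroid (Fin n × Fin m)} {S T : Finset (Fin n × Fin m)}
    (hT : TwoDemandIndep N T) (h : S ⊆ T) : TwoDemandIndep N S :=
  ⟨N.subset_indep hT.1 h, fun i =>
    (Finset.card_le_card (Finset.filter_subset_filter _ h)).trans (hT.2 i)⟩

lemma exists_greedy (N : FinMatroid (Fin n × Fin m)) (v : Fin n → Fin m → ℝ) :
    ∃ H : Finset (Fin n × Fin m), ∀ e, e ∈ H ↔
      TwoDemandIndep N (insert e (H.filter fun f => rankKey v e < rankKey v f)) := by
  classical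
  suffices h : ∀ U : Finset (Fin n × Fin m),
      (∀ e ∈ U, ∀ f, rankKey v e < rankKey v f → f ∈ U) →
      ∃ H ⊆ U, ∀ e ∈ U, e ∈ H ↔
        TwoDemandIndep N (insert e (H.filter fun f => rankKey v e < rankKey v f)) by
    obtain ⟨H, -, hH⟩ := h Finset.univ (by simp)
    exact ⟨H, fun e => hH e (Finset.mem_univ e)⟩
  intro U
  induction hk : U.card generalizing U with
  | zero =>
    intro _
    rw [Finset.card_eq_zero] at hk
    exact ⟨∅, by simp, by simp [hk]⟩
  | succ k ih =>
    intro hU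
    obtain ⟨a, haU, hamin⟩ := U.exists_min_image (rankKey v)
      (Finset.card_pos.1 (by omega))
    have hne : ∀ e ∈ U.erase a, rankKey v a < rankKey v e := fun e he =>
      lt_of_le_of_ne (hamin e (Finset.mem_of_mem_erase he))
        fun h => Finset.ne_of_mem_erase he (rankKey_injective v h).symm
    obtain ⟨H, hHU, hH⟩ := ih (U.erase a) (by rw [Finset.card_erase_of_mem haU, hk]; rfl) (by
      intro e he f hef
      exact Finset.mem_erase.2 ⟨fun h => lt_asymm hef (h ▸ hne e he),
        hU e (Finset.mem_of_mem_erase he) f hef⟩)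
    have haH : a ∉ H := fun h => Finset.notMem_erase a U (hHU h)
    have hHa : H.filter (fun f => rankKey v a < rankKey v f) = H :=
      Finset.filter_true_of_mem fun e he => hne e (hHU he)
    by_cases hadd : TwoDemandIndep N (insert a H)
    · refine ⟨insert a H, ?_, fun e he => ?_⟩
      · exact Finset.insert_subset haU (hHU.trans (Finset.erase_subset _ _))
      · rcases eq_or_ne e a with rfl | hea
        · rw [Finset.filter_insert, if_neg (lt_irrefl _), hHa]
          simpa using hadd
        · have he' := Finset.mem_erase.2 ⟨hea, he⟩
          rw [Finset.filter_insert, if_neg (hne e he').not_gt, ← hH e he', Finset.mem_insert]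
          simp [hea]
    · refine ⟨H, hHU.trans (Finset.erase_subset _ _), fun e he => ?_⟩
      rcases eq_or_ne e a with rfl | hea
      · rw [hHa]; exact iff_of_false haH hadd
      · exact hH e (Finset.mem_erase.2 ⟨hea, he⟩)

/-- The set picked by the greedy algorithm that scans pairs by decreasing value and keeps a pair
whenever the kept set stays independent in `N` with at most two pairs per agent. -/
noncomputable def greedySet (N : FinMatroid (Fin n × Fin m)) (v : Fin n → Fin m → ℝ) :
    Finset (Fin n × Fin m) :=
  (exists_greedy N v).choose

lemma mem_greedySet {N : FinMatroid (Fin n × Fin m)} {v : Fin n → Fin m → ℝ}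
    {e : Fin n × Fin m} : e ∈ greedySet N v ↔
      TwoDemandIndep N (insert e ((greedySet N v).filter fun f => rankKey v e < rankKey v f)) :=
  (exists_greedy N v).choose_spec e

lemma twoDemandIndep_greedySet {N : FinMatroid (Fin n × Fin m)} (hN : N.Indep ∅)
    (v : Fin n → Fin m → ℝ) : TwoDemandIndep N (greedySet N v) := by
  rcases (greedySet N v).eq_empty_or_nonempty with h | h
  · rw [h]; exact ⟨hN, by simp⟩
  · obtain ⟨a, ha, hmin⟩ := (greedySet N v).exists_min_image (rankKey v) h
    refine (mem_greedySet.1 ha).mono fun e he => ?_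
    rw [Finset.mem_insert, Finset.mem_filter]
    rcases eq_or_ne e a with rfl | hea
    · exact Or.inl rfl
    · exact Or.inr ⟨he, lt_of_le_of_ne (hmin e he) fun h => hea (rankKey_injective v h).symm⟩

/-- The greedy sets of two rankings agree on any common initial segment. -/
lemma mem_greedySet_congr {N : FinMatroid (Fin n × Fin m)} {v w : Fin n → Fin m → ℝ}
    {P : Fin n × Fin m → Prop} (hP : ∀ f g, P f → rankKey v f < rankKey v g → P g)
    (hvw : ∀ f g, P f → (rankKey v f < rankKey v g ↔ rankKey w f < rankKey w g))
    {f : Fin n × Fin m} (hf : P f) : f ∈ greedySet N v ↔ f ∈ greedySet N w := by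
  revert hf
  refine rankKey_induction v (P := fun f => P f → (f ∈ greedySet N v ↔ f ∈ greedySet N w))
    (fun f ih hf => ?_) f
  rw [mem_greedySet, mem_greedySet (v := w)]
  suffices h : (greedySet N v).filter (fun g => rankKey v f < rankKey v g) =
      (greedySet N w).filter fun g => rankKey w f < rankKey w g by rw [h]
  ext g
  rw [Finset.mem_filter, Finset.mem_filter, ← hvw f g hf]
  exact and_congr_left fun h => ih g h (hP f g hf h)

/-- The allocation rule serving, for each agent, the best pair in the greedy set. -/
noncomputable def topSet (N : FinMatroid (Fin n × Fin m)) (v : Fin n → Fin m → ℝ) :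
    Finset (Fin n × Fin m) :=
  (greedySet N v).filter fun e => ∀ f ∈ greedySet N v, rankKey v e < rankKey v f → f.1 ≠ e.1

lemma mem_topSet {N : FinMatroid (Fin n × Fin m)} {v : Fin n → Fin m → ℝ} {e : Fin n × Fin m} :
    e ∈ topSet N v ↔ e ∈ greedySet N v ∧
      ∀ f ∈ greedySet N v, rankKey v e < rankKey v f → f.1 ≠ e.1 :=
  Finset.mem_filter

lemma eq_of_mem_topSet {N : FinMatroid (Fin n × Fin m)} {v : Fin n → Fin m → ℝ}
    {e f : Fin n × Fin m} (he : e ∈ topSet N v) (hf : f ∈ topSet N v) (h : e.1 = f.1) : e = f := by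
  rw [mem_topSet] at he hf
  rcases lt_trichotomy (rankKey v e) (rankKey v f) with hlt | heq | hlt
  · exact absurd h.symm (he.2 f hf.1 hlt)
  · exact rankKey_injective v heq
  · exact absurd h (hf.2 e he.1 hlt)

lemma feasibleSet_topSet {N : FinMatroid (Fin n × Fin m)} (hN : N.Indep ∅)
    (v : Fin n → Fin m → ℝ) : FeasibleSet N (topSet N v) := by
  refine ⟨N.subset_indep (twoDemandIndep_greedySet hN v).1 (Finset.filter_subset _ _), fun i => ?_⟩
  refine Finset.card_le_one.2 fun a ha b hb => ?_
  rw [Finset.mem_filter] at ha hb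
  exact eq_of_mem_topSet ha.1 hb.1 (ha.2.trans hb.2.symm)

lemma exists_mem_topSet {N : FinMatroid (Fin n × Fin m)} {v : Fin n → Fin m → ℝ}
    {e : Fin n × Fin m} (he : e ∈ greedySet N v) :
    ∃ f ∈ topSet N v, f.1 = e.1 ∧ rankKey v e ≤ rankKey v f := by
  obtain ⟨f, hf, hmax⟩ := ((greedySet N v).filter fun f => f.1 = e.1).exists_max_image (rankKey v)
    ⟨e, Finset.mem_filter.2 ⟨he, rfl⟩⟩
  rw [Finset.mem_filter] at hf
  refine ⟨f, mem_topSet.2 ⟨hf.1, fun g hg hlt hgf => ?_⟩, hf.2,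
    hmax e (Finset.mem_filter.2 ⟨he, rfl⟩)⟩
  exact (hmax g (Finset.mem_filter.2 ⟨hg, hgf.trans hf.2⟩)).not_gt hlt

lemma topSet_mono {N : FinMatroid (Fin n × Fin m)} (v : Fin n → Fin m → ℝ) (i : Fin n) (j : Fin m)
    {c d : ℝ} (hcd : c ≤ d) (h : (i, j) ∈ topSet N (updateEntry v i j c)) :
    (i, j) ∈ topSet N (updateEntry v i j d) := by
  set w := updateEntry v i j c
  set w' := updateEntry v i j d
  have hkey : rankKey w (i, j) ≤ rankKey w' (i, j) := rankKey_updateEntry_mono v i j hcd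
  have hne : ∀ {f}, rankKey w' (i, j) < rankKey w' f → f ≠ (i, j) :=
    fun h h' => lt_irrefl _ (h' ▸ h)
  have hkeys : ∀ {f}, f ≠ (i, j) → rankKey w f = rankKey w' f := fun hf => by
    rw [rankKey_updateEntry_of_ne v i j c hf, rankKey_updateEntry_of_ne v i j d hf]
  have hlift : ∀ {f}, rankKey w' (i, j) < rankKey w' f → rankKey w (i, j) < rankKey w f :=
    fun hf => by rw [hkeys (hne hf)]; exact hkey.trans_lt hf
  have hagree : ∀ f, rankKey w' (i, j) < rankKey w' f →
      (f ∈ greedySet N w' ↔ f ∈ greedySet N w) := by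
    intro f hf
    refine mem_greedySet_congr (P := fun f => rankKey w' (i, j) < rankKey w' f)
      (fun f g hf hfg => hf.trans hfg) (fun f g hf => ?_) hf
    rw [hkeys (hne hf)]
    rcases eq_or_ne g (i, j) with rfl | hg
    · refine iff_of_false hf.not_gt ?_
      rw [← hkeys (hne hf)]
      exact (hlift hf).not_gt
    · rw [hkeys hg]
  rw [mem_topSet] at h ⊢
  refine ⟨mem_greedySet.2 ((mem_greedySet.1 h.1).mono ?_), fun f hf hlt =>
    h.2 f ((hagree f hlt).1 hf) (hlift hlt)⟩
  refine Finset.insert_subset_insert _ fun f hf => ?_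
  rw [Finset.mem_filter] at hf ⊢
  exact ⟨(hagree f hf.2).1 hf.1, hlift hf.2⟩

lemma topSet_congr {N : FinMatroid (Fin n × Fin m)} {v w : Fin n → Fin m → ℝ}
    (h : ∀ e f, rankKey v e < rankKey v f ↔ rankKey w e < rankKey w f) :
    topSet N v = topSet N w := by
  have hg : greedySet N v = greedySet N w := by
    ext f
    exact mem_greedySet_congr (P := fun _ => True) (fun _ _ _ _ => trivial)
      (fun f g _ => h f g) trivial
  ext e
  simp only [mem_topSet, hg, h]

lemma measurableSet_topSet_eq (N : FinMatroid (Fin n × Fin m)) (S : Finset (Fin n × Fin m)) :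
    MeasurableSet {v | topSet N v = S} := by
  let pat : (Fin n → Fin m → ℝ) → Fin n × Fin m → Fin n × Fin m → Prop :=
    fun v e f => rankKey v e < rankKey v f
  have hpat : Measurable pat := by
    refine measurable_pi_iff.2 fun e => measurable_pi_iff.2 fun f => measurableSet_setOfPred.1 ?_
    have hm : ∀ e : Fin n × Fin m, Measurable fun v : Fin n → Fin m → ℝ => v e.1 e.2 :=
      fun e => by fun_prop
    have hset : {v | pat v e f} = {v | v e.1 e.2 < v f.1 f.2} ∪
        ({v | v e.1 e.2 = v f.1 f.2} ∩ {_v | toLex e < toLex f}) :=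
      Set.ext fun v => rankKey_lt_iff
    rw [hset]
    exact (measurableSet_lt (hm e) (hm f)).union
      ((measurableSet_eq_fun (hm e) (hm f)).inter (MeasurableSet.const _))
  have : {v | topSet N v = S} = pat ⁻¹' (pat '' {v | topSet N v = S}) := by
    refine (Set.subset_preimage_image _ _).antisymm ?_
    rintro v ⟨w, hw, hwv⟩
    rw [Set.mem_ofPred_eq] at hw ⊢
    rw [← hw]
    exact topSet_congr fun e f => by simpa [pat] using (congrFun (congrFun hwv e) f).symm
  rw [this]
  exact hpat (Set.toFinite _).measurableSet

end Greedy

section Levels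

variable {n m : ℕ}

section FreePair

variable {N : FinMatroid (Fin n × Fin m)} {v : Fin n → Fin m → ℝ} {i : Fin n} {j : Fin m} {c t : ℝ}

lemma rankKey_lt_updateEntry_iff (hct : c < t) {f g : Fin n × Fin m} (hf : t ≤ v f.1 f.2)
    (hfe : f ≠ (i, j)) : rankKey (updateEntry v i j c) f < rankKey (updateEntry v i j c) g ↔
      g ≠ (i, j) ∧ rankKey v f < rankKey v g := by
  rcases eq_or_ne g (i, j) with rfl | hg
  · refine iff_of_false (fun h => ?_) (fun h => h.1 rfl)
    have := le_of_rankKey_lt h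
    rw [updateEntry_apply, updateEntry_apply, if_neg hfe, if_pos rfl] at this
    linarith
  · rw [rankKey_updateEntry_of_ne v i j c hfe, rankKey_updateEntry_of_ne v i j c hg]
    exact (and_iff_right hg).symm

/-- If a pair would be served even when bidding `c < t`, then dropping its bid to `c` does not
change the greedy set among the other pairs of value at least `t`. -/
lemma mem_greedySet_iff_of_free (hct : c < t) (ht : t ≤ v i j)
    (hfree : (i, j) ∈ topSet N (updateEntry v i j c)) {f : Fin n × Fin m} (hf : t ≤ v f.1 f.2)
    (hfe : f ≠ (i, j)) : f ∈ greedySet N v ↔ f ∈ greedySet N (updateEntry v i j c) := by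
  have hev : (i, j) ∈ greedySet N v := by
    have := topSet_mono v i j (hct.le.trans ht) hfree
    rw [updateEntry_self] at this
    exact (mem_topSet.1 this).1
  revert hf hfe
  refine rankKey_induction v (P := fun f => t ≤ v f.1 f.2 → f ≠ (i, j) →
    (f ∈ greedySet N v ↔ f ∈ greedySet N (updateEntry v i j c))) (fun f ih hf hfe => ?_) f
  constructor
  · intro hmem
    refine mem_greedySet.2 ((mem_greedySet.1 hmem).mono (Finset.insert_subset_insert _ ?_))
    intro g hg
    rw [Finset.mem_filter, rankKey_lt_updateEntry_iff hct hf hfe] at hg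
    exact Finset.mem_filter.2
      ⟨(ih g hg.2.2 (hf.trans (le_of_rankKey_lt hg.2.2)) hg.2.1).2 hg.1, hg.2.2⟩
  · intro hmem
    have hbelow : ∀ g, t ≤ v g.1 g.2 → g ≠ (i, j) →
        rankKey (updateEntry v i j c) (i, j) < rankKey (updateEntry v i j c) g := by
      intro g hg hge
      refine rankKey_lt_iff.2 (Or.inl ?_)
      rw [updateEntry_apply, updateEntry_apply, if_neg hge, if_pos rfl]
      linarith
    refine mem_greedySet.2 ((mem_greedySet.1 (mem_topSet.1 hfree).1).mono ?_)
    intro g hg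
    rw [Finset.mem_insert, Finset.mem_filter]
    rcases eq_or_ne g (i, j) with rfl | hge
    · exact Or.inl rfl
    rw [Finset.mem_insert, Finset.mem_filter] at hg
    rcases hg with rfl | hg
    · exact Or.inr ⟨hmem, hbelow g hf hfe⟩
    · have hgt := hf.trans (le_of_rankKey_lt hg.2)
      exact Or.inr ⟨(ih g hg.2 hgt hge).1 hg.1, hbelow g hgt hge⟩

lemma eq_of_mem_greedySet_of_free (hct : c < t) (ht : t ≤ v i j)
    (hfree : (i, j) ∈ topSet N (updateEntry v i j c)) {f : Fin n × Fin m}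
    (hf : f ∈ greedySet N v) (hft : t ≤ v f.1 f.2) (hfi : f.1 = i) : f = (i, j) := by
  by_contra hfe
  refine (mem_topSet.1 hfree).2 f ((mem_greedySet_iff_of_free hct ht hfree hft hfe).1 hf)
    (rankKey_lt_iff.2 (Or.inl ?_)) hfi
  rw [updateEntry_apply, updateEntry_apply, if_neg hfe, if_pos rfl]
  linarith

lemma not_twoDemandIndep_insert_erase_of_free (hct : c < t) (ht : t ≤ v i j)
    (hfree : (i, j) ∈ topSet N (updateEntry v i j c)) {f : Fin n × Fin m}
    (hf : f ∉ greedySet N v) (hft : t ≤ v f.1 f.2) (hfe : f ≠ (i, j)) :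
    ¬ TwoDemandIndep N
      (insert f (((greedySet N v).filter fun g => t ≤ v g.1 g.2).erase (i, j))) := by
  intro hind
  refine hf ((mem_greedySet_iff_of_free hct ht hfree hft hfe).2 (mem_greedySet.2 (hind.mono ?_)))
  refine Finset.insert_subset_insert _ fun g hg => ?_
  rw [Finset.mem_filter, rankKey_lt_updateEntry_iff hct hft hfe] at hg
  have hgt := hft.trans (le_of_rankKey_lt hg.2.2)
  exact Finset.mem_erase.2 ⟨hg.2.1, Finset.mem_filter.2
    ⟨(mem_greedySet_iff_of_free hct ht hfree hgt hg.2.1).2 hg.1, hgt⟩⟩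

end FreePair

/-- At every level `t`, the pairs left unserved by `topSet` have rank at most three times the
number of served pairs that could not have been served with a value below `t`. -/
lemma feasRank_unserved_le {N : FinMatroid (Fin n × Fin m)} (hN : N.Indep ∅)
    (v : Fin n → Fin m → ℝ) (t : ℝ) (P : Finset (Fin n × Fin m))
    (hP : ∀ e ∈ topSet N v, t ≤ v e.1 e.2 → e ∉ P →
      ∃ c < t, e ∈ topSet N (updateEntry v e.1 e.2 c)) :
    feasRank N (Finset.univ.filter fun e => e ∉ topSet N v ∧ t ≤ v e.1 e.2) ≤ 3 * P.card := by
  refine csSup_le ⟨0, ∅, by simp, ⟨hN, by simp⟩, rfl⟩ ?_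
  rintro _ ⟨B, hBS, hB, rfl⟩
  set J := (greedySet N v).filter fun g => t ≤ v g.1 g.2 with hJ
  have hJind : TwoDemandIndep N J :=
    (twoDemandIndep_greedySet hN v).mono (Finset.filter_subset _ _)
  have hsecond : ∀ e ∈ J, e ∉ topSet N v → ∃ g ∈ P, g.1 = e.1 := by
    intro e he hetop
    rw [hJ, Finset.mem_filter] at he
    obtain ⟨g, hg, hge, hle⟩ := exists_mem_topSet he.1
    refine ⟨g, ?_, hge⟩
    by_contra hgP
    have hne : e ≠ g := fun h => hetop (h ▸ hg)
    have hgt : t ≤ v g.1 g.2 := he.2.trans (le_of_rankKey_lt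
      (lt_of_le_of_ne hle fun h => hne (rankKey_injective v h)))
    obtain ⟨c, hct, hfree⟩ := hP g hg hgt hgP
    exact hne (eq_of_mem_greedySet_of_free hct hgt hfree he.1 he.2 hge.symm)
  set K := J.filter fun e => e ∈ topSet N v → e ∈ P with hK
  have hKcard : K.card ≤ P.card * 2 := by
    refine (Finset.card_le_card (t := P.biUnion fun p => J.filter fun e => e.1 = p.1) ?_).trans
      (Finset.card_biUnion_le_card_mul _ _ _ fun p _ => hJind.2 p.1)
    intro e he
    rw [hK, Finset.mem_filter] at he
    rw [Finset.mem_biUnion]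
    by_cases hetop : e ∈ topSet N v
    · exact ⟨e, he.2 hetop, Finset.mem_filter.2 ⟨he.1, rfl⟩⟩
    · obtain ⟨g, hg, hge⟩ := hsecond e he.1 hetop
      exact ⟨g, hg, Finset.mem_filter.2 ⟨he.1, hge.symm⟩⟩
  have hB1 : (B.filter fun f => ∃ g ∈ P, g.1 = f.1).card ≤ P.card * 1 := by
    refine (Finset.card_le_card (t := P.biUnion fun p => B.filter fun e => e.1 = p.1) ?_).trans
      (Finset.card_biUnion_le_card_mul _ _ _ fun p _ => hB.2 p.1)
    intro e he
    rw [Finset.mem_filter] at he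
    obtain ⟨g, hg, hge⟩ := he.2
    exact Finset.mem_biUnion.2 ⟨g, hg, Finset.mem_filter.2 ⟨he.1, hge.symm⟩⟩
  have hB2 : (B.filter fun f => ¬ ∃ g ∈ P, g.1 = f.1).card ≤ K.card := by
    refine N.card_le_of_forall_not_indep_insert (N.subset_indep hB.1 (Finset.filter_subset _ _))
      (N.subset_indep hJind.1 (Finset.filter_subset _ _)) fun f hf => ?_
    rw [Finset.mem_filter] at hf
    obtain ⟨-, hftop, hft⟩ := Finset.mem_filter.1 (hBS hf.1)
    have hfJ : f ∉ J := fun h => hf.2 (hsecond f h hftop)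
    have hfG : f ∉ greedySet N v := fun h => hfJ (Finset.mem_filter.2 ⟨h, hft⟩)
    have hone : ∀ S ⊆ J, N.Indep (insert f S) → TwoDemandIndep N (insert f S) := by
      intro S hS hind
      refine ⟨hind, fun i => ?_⟩
      rw [Finset.filter_insert]
      split_ifs with hi
      · refine (Finset.card_insert_le _ _).trans (Nat.succ_le_succ (Finset.card_le_one.2 ?_))
        intro a ha b hb
        rw [Finset.mem_filter] at ha hb
        have htop : ∀ x ∈ S, x.1 = i → x ∈ topSet N v := by
          intro x hx hxi
          by_contra hxtop
          obtain ⟨g, hg, hgx⟩ := hsecond x (hS hx) hxtop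
          exact hf.2 ⟨g, hg, hgx.trans (hxi.trans hi.symm)⟩
        exact eq_of_mem_topSet (htop a ha.1 ha.2) (htop b hb.1 hb.2) (ha.2.trans hb.2.symm)
      · exact (Finset.card_le_card (Finset.filter_subset_filter _ hS)).trans (hJind.2 i)
    refine N.not_indep_insert_of_exchange hJind.1 (Finset.filter_subset _ _) hfJ (fun hind => ?_)
      fun e he hind => ?_
    · refine hfG (mem_greedySet.2 ((hone J subset_rfl hind).mono ?_))
      refine Finset.insert_subset_insert _ fun g hg => ?_
      rw [Finset.mem_filter] at hg
      exact Finset.mem_filter.2 ⟨hg.1, hft.trans (le_of_rankKey_lt hg.2)⟩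
    · rw [Finset.mem_sdiff] at he
      have heJ := Finset.mem_filter.1 he.1
      have hetop : e ∈ topSet N v := by
        by_contra h
        exact he.2 (Finset.mem_filter.2 ⟨he.1, fun h' => absurd h' h⟩)
      have heP : e ∉ P := fun h => he.2 (Finset.mem_filter.2 ⟨he.1, fun _ => h⟩)
      obtain ⟨c, hct, hfree⟩ := hP e hetop heJ.2 heP
      exact not_twoDemandIndep_insert_erase_of_free hct heJ.2 hfree hfG hft
        (fun h => hftop (h ▸ hetop)) (hone _ (Finset.erase_subset _ _) hind)
  have := Finset.card_filter_add_card_filter_not (s := B) fun f => ∃ g ∈ P, g.1 = f.1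
  omega

end Levels

section ThresholdMechanism

variable {n m : ℕ}

/-- The nonnegative values of `e` at which the rule `X` serves `e`. -/
def servedBids (X : (Fin n → Fin m → ℝ) → Finset (Fin n × Fin m)) (v : Fin n → Fin m → ℝ)
    (e : Fin n × Fin m) : Set ℝ :=
  {c | 0 ≤ c ∧ e ∈ X (updateEntry v e.1 e.2 c)}

open Classical in
/-- Every served pair pays the least value at which it is served. -/
noncomputable def thresholdPay (X : (Fin n → Fin m → ℝ) → Finset (Fin n × Fin m))
    (v : Fin n → Fin m → ℝ) (e : Fin n × Fin m) : ℝ :=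
  if e ∈ X v then sInf (servedBids X v e) else 0

/-- Serving a pair is monotone in its own nonnegative value. -/
def IsMonotoneRule (X : (Fin n → Fin m → ℝ) → Finset (Fin n × Fin m)) : Prop :=
  ∀ v i j c d, 0 ≤ c → c ≤ d → (i, j) ∈ X (updateEntry v i j c) → (i, j) ∈ X (updateEntry v i j d)

variable {X : (Fin n → Fin m → ℝ) → Finset (Fin n × Fin m)}

lemma bddBelow_servedBids (v : Fin n → Fin m → ℝ) (e : Fin n × Fin m) :
    BddBelow (servedBids X v e) :=
  ⟨0, fun _ h => h.1⟩

lemma sInf_servedBids_nonneg (v : Fin n → Fin m → ℝ) (e : Fin n × Fin m) :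
    0 ≤ sInf (servedBids X v e) :=
  Real.sInf_nonneg fun _ h => h.1

lemma servedBids_updateEntry (v : Fin n → Fin m → ℝ) (i : Fin n) (j : Fin m) (c : ℝ) :
    servedBids X (updateEntry v i j c) (i, j) = servedBids X v (i, j) := by
  simp only [servedBids, updateEntry_updateEntry]

lemma mem_servedBids {v : Fin n → Fin m → ℝ} {e : Fin n × Fin m} (hv : 0 ≤ v e.1 e.2)
    (he : e ∈ X v) : v e.1 e.2 ∈ servedBids X v e :=
  ⟨hv, by rwa [updateEntry_self]⟩

lemma thresholdPay_nonneg (v : Fin n → Fin m → ℝ) (e : Fin n × Fin m) :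
    0 ≤ thresholdPay X v e := by
  unfold thresholdPay
  split_ifs
  exacts [sInf_servedBids_nonneg v e, le_rfl]

lemma thresholdPay_le {v : Fin n → Fin m → ℝ} {e : Fin n × Fin m} (hv : 0 ≤ v e.1 e.2) :
    thresholdPay X v e ≤ v e.1 e.2 := by
  unfold thresholdPay
  split_ifs with h
  exacts [csInf_le (bddBelow_servedBids v e) (mem_servedBids hv h), hv]

lemma measurable_sInf_servedBids (hmeas : ∀ e, MeasurableSet {v | e ∈ X v})
    (hmono : IsMonotoneRule X) (e : Fin n × Fin m) :
    Measurable fun v => sInf (servedBids X v e) := by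
  refine measurable_of_Iio fun a => ?_
  have hmem : ∀ c, MeasurableSet {v | c ∈ servedBids X v e} := fun c =>
    (MeasurableSet.const _).inter (measurable_updateEntry e.1 e.2 c (hmeas e))
  have hup : ∀ {v c d}, c ∈ servedBids X v e → c ≤ d → d ∈ servedBids X v e :=
    fun hc hcd => ⟨hc.1.trans hcd, hmono _ _ _ _ _ hc.1 hcd hc.2⟩
  rcases le_or_gt a 0 with ha | ha
  · convert MeasurableSet.empty using 1
    ext v
    simpa using ha.trans (sInf_servedBids_nonneg v e)
  · have : (fun v => sInf (servedBids X v e)) ⁻¹' Set.Iio a =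
        (⋃ r : ℚ, ⋃ _ : (r : ℝ) < a, {v | (r : ℝ) ∈ servedBids X v e}) ∪
          ⋂ k : ℕ, {v | (k : ℝ) ∈ servedBids X v e}ᶜ := by
      ext v
      simp only [Set.mem_preimage, Set.mem_Iio, Set.mem_union, Set.mem_iUnion, Set.mem_iInter,
        Set.mem_compl_iff, Set.mem_ofPred_eq, exists_prop]
      constructor
      · intro h
        rcases (servedBids X v e).eq_empty_or_nonempty with hem | hne
        · exact Or.inr fun k hk => by rw [hem] at hk; exact hk
        · obtain ⟨c, hc, hca⟩ := exists_lt_of_csInf_lt hne h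
          obtain ⟨r, hcr, hra⟩ := exists_rat_btwn hca
          exact Or.inl ⟨r, hra, hup hc hcr.le⟩
      · rintro (⟨r, hra, hr⟩ | h)
        · exact (csInf_le (bddBelow_servedBids v e) hr).trans_lt hra
        · have hem : servedBids X v e = ∅ := by
            refine Set.eq_empty_of_forall_notMem fun c hc => ?_
            obtain ⟨k, hk⟩ := exists_nat_ge c
            exact h k (hup hc hk)
          rwa [hem, Real.sInf_empty]
    rw [this]
    exact (MeasurableSet.iUnion fun r => MeasurableSet.iUnion fun _ => hmem _).union
      (MeasurableSet.iInter fun k => (hmem _).compl)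

/-- Threshold payments turn a monotone feasible rule into a truthful mechanism. -/
lemma isCopiesMech_thresholdPay {N : FinMatroid (Fin n × Fin m)} (hfeas : ∀ v, FeasibleSet N (X v))
    (hmeas : ∀ S, MeasurableSet {v | X v = S}) (hmono : IsMonotoneRule X) :
    IsCopiesMech n m N X (thresholdPay X) where
  feas := hfeas
  measX := hmeas
  measPay e := by
    have hmem : ∀ e, MeasurableSet {v | e ∈ X v} := fun e => by
      have : {v | e ∈ X v} = ⋃ S : Finset (Fin n × Fin m), ⋃ _ : e ∈ S, {v | X v = S} := by
        ext v; simp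
      rw [this]
      exact MeasurableSet.iUnion fun S => MeasurableSet.iUnion fun _ => hmeas S
    exact Measurable.ite (hmem e) (measurable_sInf_servedBids hmem hmono e) measurable_const
  pay_nonneg := thresholdPay_nonneg
  ic := by
    intro v hv i j c hc
    simp only [thresholdPay, servedBids_updateEntry]
    split_ifs with h1 h2 h2
    · exact le_rfl
    · have : v i j ≤ sInf (servedBids X v (i, j)) := by
        refine le_csInf ⟨c, hc, h1⟩ fun d hd => ?_
        by_contra! hlt
        refine h2 ?_
        have := hmono v i j d (v i j) hd.1 hlt.le hd.2
        rwa [updateEntry_self] at this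
      linarith
    · have := csInf_le (bddBelow_servedBids (X := X) v (i, j)) (mem_servedBids (hv i j) h2)
      simpa using this
    · exact le_rfl
  ir v hv e := by
    have := thresholdPay_le (X := X) (hv e.1 e.2)
    split_ifs with h
    · linarith
    · simp [thresholdPay, h]

end ThresholdMechanism

section Pointwise

variable {n m : ℕ}

lemma integral_indicator_le_eq {x M : ℝ} (hx : 0 ≤ x) (hxM : x ≤ M) (a : ℝ) :
    ∫ t in Set.Ioc 0 M, (if t ≤ x then a else 0) = a * x := by
  have : (fun t : ℝ => if t ≤ x then a else 0) = (Set.Iic x).indicator fun _ => a := by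
    ext t; simp [Set.indicator_apply]
  rw [this, setIntegral_indicator measurableSet_Iic, Set.Ioc_inter_Iic, min_eq_right hxM]
  simp [hx, mul_comm]

lemma integrableOn_indicator_le (x M a : ℝ) :
    IntegrableOn (fun t : ℝ => if t ≤ x then a else 0) (Set.Ioc 0 M) := by
  have : (fun t : ℝ => if t ≤ x then a else 0) = (Set.Iic x).indicator fun _ => a := by
    ext t; simp [Set.indicator_apply]
  rw [this]
  exact (integrableOn_const (by simp)).indicator measurableSet_Iic

/-- Comparing weighted counts at every positive level compares the weighted sums. -/
lemma sum_mul_le_of_levels {ι κ : Type*} (A : Finset ι) (B : Finset κ) (a x : ι → ℝ) (b y : κ → ℝ)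
    (hx : ∀ i ∈ A, 0 ≤ x i) (hy : ∀ k ∈ B, 0 ≤ y k)
    (h : ∀ t, 0 < t → ∑ i ∈ A, (if t ≤ x i then a i else 0) ≤
      ∑ k ∈ B, if t ≤ y k then b k else 0) :
    ∑ i ∈ A, a i * x i ≤ ∑ k ∈ B, b k * y k := by
  set M := ∑ i ∈ A, x i + ∑ k ∈ B, y k
  have hxM : ∀ i ∈ A, x i ≤ M := fun i hi =>
    (Finset.single_le_sum hx hi).trans (le_add_of_nonneg_right (Finset.sum_nonneg hy))
  have hyM : ∀ k ∈ B, y k ≤ M := fun k hk =>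
    (Finset.single_le_sum hy hk).trans (le_add_of_nonneg_left (Finset.sum_nonneg hx))
  rw [← Finset.sum_congr rfl fun i hi => integral_indicator_le_eq (hx i hi) (hxM i hi) (a i),
    ← Finset.sum_congr rfl fun k hk => integral_indicator_le_eq (hy k hk) (hyM k hk) (b k),
    ← integral_finsetSum _ fun i _ => integrableOn_indicator_le (x i) M (a i),
    ← integral_finsetSum _ fun k _ => integrableOn_indicator_le (y k) M (b k)]
  exact setIntegral_mono_on (integrable_finsetSum _ fun i _ => integrableOn_indicator_le _ M _)
    (integrable_finsetSum _ fun k _ => integrableOn_indicator_le _ M _) measurableSet_Ioc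
    fun t ht => h t ht.1

/-- The value of the services a lottery mechanism gives outside `topSet` is at most three times the
threshold payments of `topSet`. -/
lemma sum_unserved_le {N : FinMatroid (Fin n × Fin m)} (hN : N.Indep ∅) {v : Fin n → Fin m → ℝ}
    (hv : ∀ i j, 0 ≤ v i j) {x : Fin n × Fin m → ℝ}
    (hx : ∀ S : Finset (Fin n × Fin m), ∑ e ∈ S, x e ≤ (feasRank N S : ℝ)) :
    ∑ e with e ∉ topSet N v, x e * v e.1 e.2 ≤ 3 * ∑ e, thresholdPay (topSet N) v e := by
  rw [Finset.mul_sum]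
  refine sum_mul_le_of_levels _ _ x _ (fun _ => 3) _ (fun e _ => hv _ _)
    (fun e _ => thresholdPay_nonneg v e) fun t ht => ?_
  rw [← Finset.sum_filter, ← Finset.sum_filter, Finset.filter_filter]
  refine (hx _).trans ?_
  rw [Finset.sum_const, nsmul_eq_mul, mul_comm]
  exact_mod_cast feasRank_unserved_le hN v t _ fun e he hte heP => by
    have hlt : thresholdPay (topSet N) v e < t := by
      by_contra! h
      exact heP (Finset.mem_filter.2 ⟨Finset.mem_univ e, h⟩)
    rw [thresholdPay, if_pos he] at hlt
    obtain ⟨c, hc, hct⟩ := exists_lt_of_csInf_lt ⟨_, mem_servedBids (hv _ _) he⟩ hlt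
    exact ⟨c, hct, hc.2⟩

end Pointwise

section LotteryMechanism

variable {n m : ℕ}

/-- The utility of agent `i` at profile `v`. -/
def lotteryUtil (q : (Fin n → Fin m → ℝ) → Fin n → Fin m → ℝ)
    (p : (Fin n → Fin m → ℝ) → Fin n → ℝ) (v : Fin n → Fin m → ℝ) (i : Fin n) : ℝ :=
  (∑ j, q v i j * v i j) - p v i

section Properties

variable {N : FinMatroid (Fin n × Fin m)} {menu : Fin n → (Fin n → Fin m → ℝ) → Set (Lottery m)}
  {q : (Fin n → Fin m → ℝ) → Fin n → Fin m → ℝ} {p : (Fin n → Fin m → ℝ) → Fin n → ℝ}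
  {v w : Fin n → Fin m → ℝ}

lemma IsLotteryMech.q_nonneg (h : IsLotteryMech n m N menu q p) (hv : ∀ i j, 0 ≤ v i j)
    (i : Fin n) (j : Fin m) : 0 ≤ q v i j := by
  rcases h.choice v hv i with ⟨l, -, hq, -⟩ | ⟨hq, -⟩
  · exact hq ▸ l.q_nonneg j
  · simp [hq]

lemma IsLotteryMech.q_le_one (h : IsLotteryMech n m N menu q p) (hv : ∀ i j, 0 ≤ v i j)
    (i : Fin n) (j : Fin m) : q v i j ≤ 1 := by
  rcases h.choice v hv i with ⟨l, -, hq, -⟩ | ⟨hq, -⟩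
  · rw [← hq]
    exact (Finset.single_le_sum (fun j _ => l.q_nonneg j) (Finset.mem_univ j)).trans
      l.q_sum_le_one
  · simp [hq]

lemma IsLotteryMech.p_nonneg (h : IsLotteryMech n m N menu q p) (hv : ∀ i j, 0 ≤ v i j)
    (i : Fin n) : 0 ≤ p v i := by
  rcases h.choice v hv i with ⟨l, -, -, hp, -⟩ | ⟨-, hp, -⟩
  · exact hp ▸ l.p_nonneg
  · exact hp.ge

lemma IsLotteryMech.lotteryUtil_nonneg (h : IsLotteryMech n m N menu q p)
    (hv : ∀ i j, 0 ≤ v i j) (i : Fin n) : 0 ≤ lotteryUtil q p v i := by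
  rcases h.choice v hv i with ⟨l, -, hq, hp, hu, -⟩ | ⟨hq, hp, -⟩
  · rw [lotteryUtil, ← hq, ← hp]; exact hu
  · simp [lotteryUtil, hq, hp]

/-- No agent gains by misreporting its row of values. -/
lemma IsLotteryMech.misreport_le (h : IsLotteryMech n m N menu q p) (hv : ∀ i j, 0 ≤ v i j)
    (hw : ∀ i j, 0 ≤ w i j) {i : Fin n} (hvw : ∀ i', i' ≠ i → v i' = w i') :
    (∑ j, q w i j * v i j) - p w i ≤ lotteryUtil q p v i := by
  rcases h.choice w hw i with ⟨l, hl, hq, hp, -⟩ | ⟨hq, hp, -⟩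
  · rw [← h.menu_indep i v w hvw] at hl
    have hlu : l.util (v i) = (∑ j, q w i j * v i j) - p w i := by rw [Lottery.util, hq, hp]
    rw [← hlu]
    rcases h.choice v hv i with ⟨l', -, hq', hp', -, hmax⟩ | ⟨hq', hp', hmax⟩
    · rw [lotteryUtil, ← hq', ← hp']
      exact hmax l hl
    · refine (hmax l hl).trans ?_
      simp [lotteryUtil, hq', hp']
  · simpa [hq, hp] using h.lotteryUtil_nonneg hv i

/-- The allocation probability of `(i, j)` is a subgradient of agent `i`'s utility in `v i j`. -/
lemma IsLotteryMech.subgradient (h : IsLotteryMech n m N menu q p) (hv : ∀ i j, 0 ≤ v i j)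
    (i : Fin n) (j : Fin m) {c d : ℝ} (hc : 0 ≤ c) (hd : 0 ≤ d) :
    (d - c) * q (updateEntry v i j c) i j ≤
      lotteryUtil q p (updateEntry v i j d) i - lotteryUtil q p (updateEntry v i j c) i := by
  have h1 := h.misreport_le (updateEntry_nonneg hv i j hd) (updateEntry_nonneg hv i j hc) (i := i)
    fun i' hi' => by simp [updateEntry, hi']
  have h2 : ∑ k, q (updateEntry v i j c) i k * updateEntry v i j d i k =
      ∑ k, q (updateEntry v i j c) i k * updateEntry v i j c i k +
        (d - c) * q (updateEntry v i j c) i j := by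
    rw [← sub_eq_iff_eq_add', ← Finset.sum_sub_distrib, Finset.sum_eq_single j]
    · simp [updateEntry]; ring
    · intro k _ hk
      simp [updateEntry, hk]
    · simp
  rw [h2] at h1
  rw [lotteryUtil] at h1 ⊢
  rw [lotteryUtil]
  linarith

lemma IsLotteryMech.q_mono (h : IsLotteryMech n m N menu q p) (hv : ∀ i j, 0 ≤ v i j)
    (i : Fin n) (j : Fin m) {c d : ℝ} (hc : 0 ≤ c) (hcd : c ≤ d) :
    q (updateEntry v i j c) i j ≤ q (updateEntry v i j d) i j := by
  rcases hcd.eq_or_lt with rfl | hlt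
  · exact le_rfl
  · have h1 := h.subgradient hv i j hc (hc.trans hcd)
    have h2 := h.subgradient hv i j (hc.trans hcd) hc
    nlinarith

lemma IsLotteryMech.p_le (h : IsLotteryMech n m N menu q p) (hv : ∀ i j, 0 ≤ v i j)
    (i : Fin n) : p v i ≤ ∑ j, q v i j * v i j := by
  have := h.lotteryUtil_nonneg hv i
  rw [lotteryUtil] at this
  linarith

end Properties

open Classical in
/-- The rule that serves the pairs in `topSet` with allocation probability above `θ`. -/
noncomputable def quantileRule (N : FinMatroid (Fin n × Fin m))
    (q : (Fin n → Fin m → ℝ) → Fin n → Fin m → ℝ) (θ : ℝ) (v : Fin n → Fin m → ℝ) :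
    Finset (Fin n × Fin m) :=
  if ∀ i j, 0 ≤ v i j then (topSet N v).filter fun e => θ < q v e.1 e.2 else ∅

variable {N : FinMatroid (Fin n × Fin m)} {menu : Fin n → (Fin n → Fin m → ℝ) → Set (Lottery m)}
  {q : (Fin n → Fin m → ℝ) → Fin n → Fin m → ℝ} {p : (Fin n → Fin m → ℝ) → Fin n → ℝ}

lemma mem_quantileRule {θ : ℝ} {v : Fin n → Fin m → ℝ} {e : Fin n × Fin m} :
    e ∈ quantileRule N q θ v ↔ (∀ i j, 0 ≤ v i j) ∧ e ∈ topSet N v ∧ θ < q v e.1 e.2 := by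
  unfold quantileRule
  split_ifs with h
  · simp [h]
  · exact iff_of_false (Finset.notMem_empty e) fun h' => h h'.1

lemma quantileRule_subset (θ : ℝ) (v : Fin n → Fin m → ℝ) :
    quantileRule N q θ v ⊆ topSet N v :=
  fun _ he => (mem_quantileRule.1 he).2.1

lemma FeasibleSet.mono {S T : Finset (Fin n × Fin m)} (hT : FeasibleSet N T) (h : S ⊆ T) :
    FeasibleSet N S :=
  ⟨N.subset_indep hT.1 h, fun i =>
    (Finset.card_le_card (Finset.filter_subset_filter _ h)).trans (hT.2 i)⟩

lemma isCopiesMech_topSet (hN : N.Indep ∅) :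
    IsCopiesMech n m N (topSet N) (thresholdPay (topSet N)) :=
  isCopiesMech_thresholdPay (feasibleSet_topSet hN) (measurableSet_topSet_eq N)
    fun v i j _ _ _ hcd h => topSet_mono v i j hcd h

lemma measurableSet_quantileRule_eq (h : IsLotteryMech n m N menu q p) (θ : ℝ)
    (S : Finset (Fin n × Fin m)) : MeasurableSet {v | quantileRule N q θ v = S} := by
  have hmem : ∀ e, MeasurableSet {v | e ∈ quantileRule N q θ v} := by
    intro e
    have h1 : {v | e ∈ quantileRule N q θ v} =
        (⋂ i, ⋂ j, {v : Fin n → Fin m → ℝ | 0 ≤ v i j}) ∩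
          ((⋃ S : Finset (Fin n × Fin m), ⋃ _ : e ∈ S, {v | topSet N v = S}) ∩
            {v | θ < q v e.1 e.2}) := by
      ext v
      simp [mem_quantileRule]
    rw [h1]
    refine (MeasurableSet.iInter fun i => MeasurableSet.iInter fun j =>
      measurableSet_le measurable_const (by fun_prop)).inter
      ((MeasurableSet.iUnion fun S => MeasurableSet.iUnion fun _ =>
        measurableSet_topSet_eq N S).inter (measurableSet_lt measurable_const (h.measQ e.1 e.2)))
  have h2 : {v | quantileRule N q θ v = S} =
      ⋂ e, if e ∈ S then {v | e ∈ quantileRule N q θ v} else {v | e ∈ quantileRule N q θ v}ᶜ := by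
    ext v
    rw [Set.mem_iInter, Set.mem_ofPred_eq, Finset.ext_iff]
    refine forall_congr' fun e => ?_
    by_cases he : e ∈ S <;> simp [he]
  rw [h2]
  refine MeasurableSet.iInter fun e => ?_
  split_ifs
  exacts [hmem e, (hmem e).compl]

lemma isCopiesMech_quantileRule (hN : N.Indep ∅) (h : IsLotteryMech n m N menu q p) (θ : ℝ) :
    IsCopiesMech n m N (quantileRule N q θ) (thresholdPay (quantileRule N q θ)) := by
  refine isCopiesMech_thresholdPay
    (fun v => (feasibleSet_topSet hN v).mono (quantileRule_subset θ v))
    (measurableSet_quantileRule_eq h θ) fun v i j c d hc hcd hmem => ?_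
  rw [mem_quantileRule] at hmem ⊢
  have hnn : ∀ a b, 0 ≤ updateEntry v i j d a b := by
    have := updateEntry_nonneg hmem.1 i j (hc.trans hcd)
    rwa [updateEntry_updateEntry] at this
  refine ⟨hnn, topSet_mono v i j hcd hmem.2.1, hmem.2.2.trans_le ?_⟩
  have := h.q_mono hmem.1 i j hc hcd
  rwa [updateEntry_updateEntry, updateEntry_updateEntry] at this

/-- A utility curve whose subgradient exceeds `k / K` on `T k` rises at least as fast as the
average surplus over the thresholds `sInf (T k)`. -/
lemma sum_sub_sInf_le {T : ℕ → Set ℝ} {u s : ℝ → ℝ} {K : ℕ} (hK : 0 < K)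
    (hT : ∀ k, ∀ c ∈ T k, 0 ≤ c) (hanti : ∀ k, T (k + 1) ⊆ T k)
    (hsub : ∀ c d, 0 ≤ c → 0 ≤ d → (d - c) * s c ≤ u d - u c) (hs0 : 0 ≤ s 0)
    (hs : ∀ k, ∀ c ∈ T k, (k : ℝ) / K ≤ s c) (k : ℕ) :
    ∀ c ∈ T k, ∑ l ∈ Finset.range k, (c - sInf (T (l + 1))) ≤ K * (u c - u 0) := by
  have hK' : (0 : ℝ) < K := by exact_mod_cast hK
  induction k with
  | zero =>
    intro c hc
    have := hsub 0 c le_rfl (hT 0 c hc)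
    have := mul_nonneg (sub_nonneg.2 (hT 0 c hc)) hs0
    rw [Finset.sum_range_zero]
    exact mul_nonneg hK'.le (by linarith)
  | succ k ih =>
    intro c hc
    refine le_of_forall_pos_le_add fun ε hε => ?_
    obtain ⟨a, ha, hlt⟩ := exists_lt_of_csInf_lt ⟨c, hc⟩ (lt_add_of_pos_right (sInf (T (k + 1))) hε)
    obtain ⟨d, hd, hdc, hdlt⟩ : ∃ d ∈ T (k + 1), d ≤ c ∧ d < sInf (T (k + 1)) + ε := by
      rcases le_total a c with h | h
      · exact ⟨a, ha, h, hlt⟩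
      · exact ⟨c, hc, le_rfl, h.trans_lt hlt⟩
    have h1 := ih d (hanti k hd)
    have h2 := hsub d c (hT _ d hd) (hT _ c hc)
    have h3 : (c - d) * (k + 1) ≤ K * (u c - u d) := by
      have h4 := hs (k + 1) d hd
      push_cast at h4
      rw [div_le_iff₀ hK'] at h4
      have := mul_le_mul_of_nonneg_left h4 (sub_nonneg.2 hdc)
      nlinarith
    rw [Finset.sum_range_succ]
    have h5 : ∑ l ∈ Finset.range k, (c - sInf (T (l + 1))) =
        ∑ l ∈ Finset.range k, (d - sInf (T (l + 1))) + (c - d) * k := by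
      simp only [Finset.sum_sub_distrib, Finset.sum_const, Finset.card_range, nsmul_eq_mul]
      ring
    rw [h5]
    linarith

/-- For a pair in `topSet`, averaging the quantile rules recovers the surplus the lottery mechanism
extracts through that pair. -/
lemma surplus_le_sum_quantileRule (h : IsLotteryMech n m N menu q p) {v : Fin n → Fin m → ℝ}
    (hv : ∀ i j, 0 ≤ v i j) {i : Fin n} {j : Fin m} (he : (i, j) ∈ topSet N v) {K : ℕ}
    (hK : 0 < K) :
    K * (q v i j * v i j - lotteryUtil q p v i) ≤
      ∑ k ∈ Finset.range K, thresholdPay (quantileRule N q (k / K)) v (i, j) + v i j := by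
  have hK' : (0 : ℝ) < K := by exact_mod_cast hK
  have hq0 := h.q_nonneg hv i j
  have hsum : 0 ≤ ∑ k ∈ Finset.range K, thresholdPay (quantileRule N q (k / K)) v (i, j) :=
    Finset.sum_nonneg fun k _ => thresholdPay_nonneg _ _
  have hu0 : 0 ≤ lotteryUtil q p (updateEntry v i j 0) i :=
    h.lotteryUtil_nonneg (updateEntry_nonneg hv i j le_rfl) i
  rcases hq0.eq_or_lt with hq | hq
  · have h1 := h.lotteryUtil_nonneg hv i
    rw [← hq]
    have := mul_nonneg hK'.le h1
    have := hv i j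
    linarith
  obtain ⟨k, hk⟩ : ∃ k, ⌈q v i j * K⌉₊ = k + 1 :=
    Nat.exists_eq_succ_of_ne_zero (Nat.ceil_pos.2 (mul_pos hq hK')).ne'
  have hkq : (k : ℝ) < q v i j * K := Nat.lt_ceil.1 (by omega)
  have hqk : q v i j * K ≤ k + 1 := by
    have := Nat.le_ceil (q v i j * K)
    rw [hk] at this
    exact_mod_cast this
  have hkK : k < K := by
    have : q v i j * K ≤ 1 * K := mul_le_mul_of_nonneg_right (h.q_le_one hv i j) hK'.le
    exact_mod_cast (by linarith : (k : ℝ) < K)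
  have hmemT : ∀ l ≤ k, (i, j) ∈ quantileRule N q (l / K) v := by
    intro l hl
    refine mem_quantileRule.2 ⟨hv, he, (div_lt_iff₀ hK').2 (lt_of_le_of_lt ?_ hkq)⟩
    exact_mod_cast hl
  have hmain := sum_sub_sInf_le (T := fun l => servedBids (quantileRule N q (l / K)) v (i, j))
    (u := fun c => lotteryUtil q p (updateEntry v i j c) i)
    (s := fun c => q (updateEntry v i j c) i j) hK (fun l c hc => hc.1)
    (fun l c hc => by
      refine ⟨hc.1, ?_⟩
      have := mem_quantileRule.1 hc.2
      refine mem_quantileRule.2 ⟨this.1, this.2.1, lt_of_le_of_lt ?_ this.2.2⟩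
      gcongr
      simp)
    (fun c d hc hd => h.subgradient hv i j hc hd)
    (h.q_nonneg (updateEntry_nonneg hv i j le_rfl) i j)
    (fun l c hc => (mem_quantileRule.1 hc.2).2.2.le) k (v i j)
    (mem_servedBids (e := (i, j)) (hv i j) (hmemT k le_rfl))
  simp only [updateEntry_self] at hmain
  rw [Finset.sum_sub_distrib, Finset.sum_const, Finset.card_range, nsmul_eq_mul] at hmain
  have hpay : ∑ l ∈ Finset.range k,
      sInf (servedBids (quantileRule N q ((l + 1 : ℕ) / K)) v (i, j)) ≤
      ∑ l ∈ Finset.range K, thresholdPay (quantileRule N q (l / K)) v (i, j) := by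
    calc _ ≤ ∑ l ∈ Finset.range (k + 1), thresholdPay (quantileRule N q (l / K)) v (i, j) := by
          rw [Finset.sum_range_succ']
          refine le_add_of_le_of_nonneg (Finset.sum_le_sum fun l hl => ?_) (thresholdPay_nonneg _ _)
          rw [Finset.mem_range] at hl
          rw [thresholdPay, if_pos (hmemT (l + 1) hl)]
      _ ≤ _ := Finset.sum_le_sum_of_subset_of_nonneg (Finset.range_subset_range.2 hkK)
          fun l _ _ => thresholdPay_nonneg _ _
  have := mul_le_mul_of_nonneg_right hqk (hv i j)
  nlinarith

/-- Pointwise bound on the payments of a lottery mechanism by those of `topSet` and of the quantile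
rules, up to a discretization error. -/
lemma sum_p_le (hN : N.Indep ∅) (h : IsLotteryMech n m N menu q p) {v : Fin n → Fin m → ℝ}
    (hv : ∀ i j, 0 ≤ v i j) {K : ℕ} (hK : 0 < K) :
    ∑ i, p v i ≤ (∑ k ∈ Finset.range K, ∑ e, thresholdPay (quantileRule N q (k / K)) v e +
      ∑ e : Fin n × Fin m, v e.1 e.2) / K + 3 * ∑ e, thresholdPay (topSet N) v e := by
  have hK' : (0 : ℝ) < K := by exact_mod_cast hK
  set a : Fin n × Fin m → ℝ := fun e =>
    (∑ k ∈ Finset.range K, thresholdPay (quantileRule N q (k / K)) v e + v e.1 e.2) / K with ha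
  have ha0 : ∀ e, 0 ≤ a e := fun e => div_nonneg (add_nonneg
    (Finset.sum_nonneg fun k _ => thresholdPay_nonneg _ _) (hv _ _)) hK'.le
  have hagent : ∀ i, p v i ≤
      ∑ j, (a (i, j) + if (i, j) ∉ topSet N v then q v i j * v i j else 0) := by
    intro i
    by_cases hi : ∃ j, (i, j) ∈ topSet N v
    · obtain ⟨j, hj⟩ := hi
      have h1 := surplus_le_sum_quantileRule h hv hj hK
      have h2 : q v i j * v i j - lotteryUtil q p v i ≤ a (i, j) := by
        rw [ha, le_div_iff₀ hK']
        linarith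
      have h3 : ∑ k, q v i k * v i k ≤ q v i j * v i j +
          ∑ k, if (i, k) ∉ topSet N v then q v i k * v i k else 0 := by
        rw [← Finset.add_sum_erase _ _ (Finset.mem_univ j)]
        refine add_le_add_right ((Finset.sum_le_sum fun k hk => ?_).trans
          (Finset.sum_le_sum_of_subset_of_nonneg (Finset.erase_subset j _) fun k _ _ => ?_)) _
        · have hkt : (i, k) ∉ topSet N v := fun hk' => Finset.ne_of_mem_erase hk
            (congrArg Prod.snd (eq_of_mem_topSet hk' hj rfl : ((i, k) : Fin n × Fin m) = (i, j)))
          rw [if_pos hkt]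
        · split_ifs
          exacts [le_rfl, mul_nonneg (h.q_nonneg hv _ _) (hv _ _)]
      have h4 : a (i, j) ≤ ∑ k, a (i, k) :=
        Finset.single_le_sum (fun k _ => ha0 (i, k)) (Finset.mem_univ j)
      rw [Finset.sum_add_distrib]
      rw [lotteryUtil] at h2
      linarith
    · refine (h.p_le hv i).trans (Finset.sum_le_sum fun j _ => ?_)
      rw [if_pos fun hj => hi ⟨j, hj⟩]
      exact le_add_of_nonneg_left (ha0 _)
  have h1 := Finset.sum_le_sum fun i (_ : i ∈ Finset.univ) => hagent i
  rw [← Fintype.sum_prod_type' fun i j =>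
    a (i, j) + if (i, j) ∉ topSet N v then q v i j * v i j else 0, Finset.sum_add_distrib,
    ← Finset.sum_filter] at h1
  have h2 := sum_unserved_le hN hv (x := fun e => q v e.1 e.2) (h.feas v)
  have h3 : ∑ e, a e = (∑ k ∈ Finset.range K, ∑ e, thresholdPay (quantileRule N q (k / K)) v e +
      ∑ e : Fin n × Fin m, v e.1 e.2) / K := by
    rw [ha, ← Finset.sum_div, Finset.sum_add_distrib, Finset.sum_comm]
  rw [← h3]
  exact h1.trans (add_le_add_right h2 _)

end LotteryMechanism

section Revenue

variable {n m : ℕ} {N : FinMatroid (Fin n × Fin m)} {F : Fin n → Fin m → Measure ℝ}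

instance [∀ i j, IsProbabilityMeasure (F i j)] : IsProbabilityMeasure (valMeasure F) := by
  unfold valMeasure
  infer_instance

lemma measurePreserving_entry [∀ i j, IsProbabilityMeasure (F i j)] (i : Fin n) (j : Fin m) :
    MeasurePreserving (fun v : Fin n → Fin m → ℝ => v i j) (valMeasure F) (F i j) :=
  (measurePreserving_eval (F i) j).comp
    (measurePreserving_eval (fun i => Measure.pi fun j => F i j) i)

lemma ae_entry_nonneg [∀ i j, IsProbabilityMeasure (F i j)]
    (hF : ∀ i j, F i j (Set.Iio 0) = 0) : ∀ᵐ v ∂valMeasure F, ∀ i j, 0 ≤ v i j := by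
  refine ae_all_iff.2 fun i => ae_all_iff.2 fun j => ?_
  refine (measurePreserving_entry i j).quasiMeasurePreserving.ae (p := fun x => 0 ≤ x) ?_
  rw [ae_iff]
  simp only [not_le]
  exact hF i j

lemma integrable_sum_entry [∀ i j, IsProbabilityMeasure (F i j)]
    (hF : ∀ i j, Integrable id (F i j)) :
    Integrable (fun v => ∑ e : Fin n × Fin m, v e.1 e.2) (valMeasure F) :=
  integrable_finsetSum _ fun e _ =>
    (measurePreserving_entry e.1 e.2).integrable_comp_of_integrable (hF e.1 e.2)

lemma IsCopiesMech.sum_pay_le {X : (Fin n → Fin m → ℝ) → Finset (Fin n × Fin m)}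
    {pay : (Fin n → Fin m → ℝ) → Fin n × Fin m → ℝ} (h : IsCopiesMech n m N X pay)
    {v : Fin n → Fin m → ℝ} (hv : ∀ i j, 0 ≤ v i j) :
    ∑ e, pay v e ≤ ∑ e : Fin n × Fin m, v e.1 e.2 := by
  refine Finset.sum_le_sum fun e _ => ?_
  have h1 := h.ir v hv e
  have h2 := hv e.1 e.2
  split_ifs at h1 <;> linarith

lemma IsCopiesMech.integrable_sum_pay [∀ i j, IsProbabilityMeasure (F i j)]
    (hF_nonneg : ∀ i j, F i j (Set.Iio 0) = 0) (hF_mean : ∀ i j, Integrable id (F i j))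
    {X : (Fin n → Fin m → ℝ) → Finset (Fin n × Fin m)}
    {pay : (Fin n → Fin m → ℝ) → Fin n × Fin m → ℝ} (h : IsCopiesMech n m N X pay) :
    Integrable (fun v => ∑ e, pay v e) (valMeasure F) := by
  refine (integrable_sum_entry hF_mean).mono'
    (Finset.measurable_fun_sum _ fun e _ => h.measPay e).aestronglyMeasurable ?_
  filter_upwards [ae_entry_nonneg hF_nonneg] with v hv
  rw [Real.norm_of_nonneg (Finset.sum_nonneg fun e _ => h.pay_nonneg v e)]
  exact h.sum_pay_le hv

lemma bddAbove_copiesRevenue [∀ i j, IsProbabilityMeasure (F i j)]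
    (hF_nonneg : ∀ i j, F i j (Set.Iio 0) = 0) (hF_mean : ∀ i j, Integrable id (F i j)) :
    BddAbove {r : ℝ | ∃ (X : (Fin n → Fin m → ℝ) → Finset (Fin n × Fin m))
      (pay : (Fin n → Fin m → ℝ) → Fin n × Fin m → ℝ),
      IsCopiesMech n m N X pay ∧ r = copiesRevenue F pay} := by
  refine ⟨∫ v, ∑ e : Fin n × Fin m, v e.1 e.2 ∂valMeasure F, ?_⟩
  rintro r ⟨X, pay, h, rfl⟩
  refine integral_mono_ae (h.integrable_sum_pay hF_nonneg hF_mean)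
    (integrable_sum_entry hF_mean) ?_
  filter_upwards [ae_entry_nonneg hF_nonneg] with v hv using h.sum_pay_le hv

lemma lotteryMechRevenue_nonpos_of_not_indep [∀ i j, IsProbabilityMeasure (F i j)]
    (hF_nonneg : ∀ i j, F i j (Set.Iio 0) = 0) (hN : ¬ N.Indep ∅)
    {menu : Fin n → (Fin n → Fin m → ℝ) → Set (Lottery m)}
    {q : (Fin n → Fin m → ℝ) → Fin n → Fin m → ℝ} {p : (Fin n → Fin m → ℝ) → Fin n → ℝ}
    (h : IsLotteryMech n m N menu q p) : lotteryMechRevenue F p ≤ 0 := by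
  refine integral_nonpos_of_ae ?_
  filter_upwards [ae_entry_nonneg hF_nonneg] with v hv
  refine Finset.sum_nonpos fun i _ => (h.p_le hv i).trans (Finset.sum_nonpos fun j _ => ?_)
  refine mul_nonpos_of_nonpos_of_nonneg ?_ (hv i j)
  have hrank : feasRank N {(i, j)} = 0 := by
    refine (congrArg sSup (Set.eq_empty_of_forall_notMem ?_)).trans csSup_empty
    rintro c ⟨M, -, hM, -⟩
    exact hN (N.subset_indep hM.1 (Finset.empty_subset M))
  simpa [hrank] using h.feas v {(i, j)}

lemma lotteryMechRevenue_le_of_indep [∀ i j, IsProbabilityMeasure (F i j)]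
    (hF_nonneg : ∀ i j, F i j (Set.Iio 0) = 0) (hF_mean : ∀ i j, Integrable id (F i j))
    (hN : N.Indep ∅) {menu : Fin n → (Fin n → Fin m → ℝ) → Set (Lottery m)}
    {q : (Fin n → Fin m → ℝ) → Fin n → Fin m → ℝ} {p : (Fin n → Fin m → ℝ) → Fin n → ℝ}
    (h : IsLotteryMech n m N menu q p) {s : ℝ}
    (hs : ∀ X pay, IsCopiesMech n m N X pay → copiesRevenue F pay ≤ s) {K : ℕ} (hK : 0 < K) :
    lotteryMechRevenue F p ≤
      4 * s + (∫ v, ∑ e : Fin n × Fin m, v e.1 e.2 ∂valMeasure F) / K := by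
  have hK' : (0 : ℝ) < K := by exact_mod_cast hK
  have hquant : ∀ θ : ℝ, Integrable (fun v => ∑ e, thresholdPay (quantileRule N q θ) v e)
      (valMeasure F) := fun θ =>
    (isCopiesMech_quantileRule hN h θ).integrable_sum_pay hF_nonneg hF_mean
  have htop := (isCopiesMech_topSet hN).integrable_sum_pay hF_nonneg hF_mean
  have hsum := integrable_finsetSum (Finset.range K) fun k _ => hquant (k / K)
  have hval := integrable_sum_entry hF_mean
  have havg : Integrable (fun v =>
      (∑ k ∈ Finset.range K, ∑ e, thresholdPay (quantileRule N q (k / K)) v e +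
        ∑ e : Fin n × Fin m, v e.1 e.2) / K) (valMeasure F) := (hsum.add hval).div_const _
  have hle : lotteryMechRevenue F p ≤ ∫ v,
      ((∑ k ∈ Finset.range K, ∑ e, thresholdPay (quantileRule N q (k / K)) v e +
        ∑ e : Fin n × Fin m, v e.1 e.2) / K + 3 * ∑ e, thresholdPay (topSet N) v e)
        ∂valMeasure F := by
    refine integral_mono_of_nonneg ?_ (havg.add (htop.const_mul 3)) ?_
    · filter_upwards [ae_entry_nonneg hF_nonneg] with v hv
      exact Finset.sum_nonneg fun i _ => h.p_nonneg hv i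
    · filter_upwards [ae_entry_nonneg hF_nonneg] with v hv using sum_p_le hN h hv hK
  rw [integral_add havg (htop.const_mul 3), integral_div,
    integral_add hsum hval, integral_finsetSum _ fun (k : ℕ) _ => hquant (k / K),
    integral_const_mul] at hle
  have h1 : ∑ k ∈ Finset.range K,
      ∫ v, ∑ e, thresholdPay (quantileRule N q (k / K)) v e ∂valMeasure F ≤ K * s := by
    refine (Finset.sum_le_card_nsmul _ _ s fun (k : ℕ) _ =>
      hs _ _ (isCopiesMech_quantileRule hN h (k / K))).trans_eq ?_
    rw [Finset.card_range, nsmul_eq_mul]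
  have h2 : ∫ v, ∑ e, thresholdPay (topSet N) v e ∂valMeasure F ≤ s :=
    hs _ _ (isCopiesMech_topSet hN)
  have h3 := div_le_div_of_nonneg_right h1 hK'.le
  rw [mul_div_cancel_left₀ _ hK'.ne'] at h3
  rw [add_div] at hle
  linarith

end Revenue

/-- For `n` unit-demand agents, `m` services, independent
values `v i j ∼ F i j` (Borel distributions on `ℝ≥0` with finite mean), and
feasibility given by a matroid `N` on `[n] × [m]` intersected with the
unit-demand constraint, the expected revenue of every lottery-based mechanism
for the multi-agent instance is at most `5` times the supremum of expected
revenue over IC, IR deterministic mechanisms for the copies instance. -/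
theorem lotteryMech_le_five_copiesSup_matroid
    {n m : ℕ} (N : FinMatroid (Fin n × Fin m))
    (F : Fin n → Fin m → Measure ℝ) [∀ i j, IsProbabilityMeasure (F i j)]
    (hF_nonneg : ∀ i j, F i j (Set.Iio 0) = 0)
    (hF_mean : ∀ i j, Integrable id (F i j))
    (menu : Fin n → (Fin n → Fin m → ℝ) → Set (Lottery m))
    (q : (Fin n → Fin m → ℝ) → Fin n → Fin m → ℝ)
    (p : (Fin n → Fin m → ℝ) → Fin n → ℝ)
    (hmech : IsLotteryMech n m N menu q p) :
    lotteryMechRevenue F p ≤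
      5 * sSup {r : ℝ | ∃ (X : (Fin n → Fin m → ℝ) → Finset (Fin n × Fin m))
        (pay : (Fin n → Fin m → ℝ) → Fin n × Fin m → ℝ),
        IsCopiesMech n m N X pay ∧ r = copiesRevenue F pay} := by
  set R := {r : ℝ | ∃ (X : (Fin n → Fin m → ℝ) → Finset (Fin n × Fin m))
    (pay : (Fin n → Fin m → ℝ) → Fin n × Fin m → ℝ),
    IsCopiesMech n m N X pay ∧ r = copiesRevenue F pay} with hR
  by_cases hN : N.Indep ∅
  · have hs : ∀ X pay, IsCopiesMech n m N X pay → copiesRevenue F pay ≤ sSup R :=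
      fun X pay h => le_csSup (bddAbove_copiesRevenue hF_nonneg hF_mean) ⟨X, pay, h, rfl⟩
    have hs0 : 0 ≤ sSup R := by
      refine le_trans ?_ (hs _ _ (isCopiesMech_topSet hN))
      exact integral_nonneg fun v => Finset.sum_nonneg fun e _ => thresholdPay_nonneg v e
    have hlim : Filter.Tendsto (fun K : ℕ => 4 * sSup R +
        (∫ v, ∑ e : Fin n × Fin m, v e.1 e.2 ∂valMeasure F) / K) Filter.atTop
        (nhds (4 * sSup R + 0)) :=
      tendsto_const_nhds.add (tendsto_const_div_atTop_nhds_zero_nat _)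
    have hle := ge_of_tendsto hlim <| (Filter.eventually_gt_atTop 0).mono fun K hK =>
      lotteryMechRevenue_le_of_indep hF_nonneg hF_mean hN hmech hs hK
    linarith
  · have hempty : R = ∅ := by
      refine Set.eq_empty_of_forall_notMem ?_
      rintro r ⟨X, pay, h, -⟩
      exact hN (N.subset_indep (h.feas 0).1 (Finset.empty_subset _))
    rw [hempty, Real.sSup_empty, mul_zero]
    exact lotteryMechRevenue_nonpos_of_not_indep hF_nonneg hN hmech
end

section
/- Consider n unit-demand agents, m items with capacities k_j ≥ 1, and independent values v_ij ∼ F_ij (Borel distributions on ℝ_{≥0} with finite mean). The expected revenue of every dominant-strategy incentive compatible, individually rational randomized mechanism for the multi-agent unit-demand instance is at most 33.75 times the supremum of expected revenue over all dominant-strategy incentive compatible, individually rational deterministic mechanisms for the instance. -/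
open MeasureTheory

/-- `S` is a matching: each agent `i` appears in at most one pair of `S` and
each item `j` appears in at most `k j` pairs of `S`. -/
def IsMatching (n m : ℕ) (k : Fin m → ℕ) (S : Finset (Fin n × Fin m)) : Prop :=
  (∀ i : Fin n, (S.filter fun e => e.1 = i).card ≤ 1) ∧
  (∀ j : Fin m, (S.filter fun e => e.2 = j).card ≤ k j)

/-- A dominant-strategy IC, IR randomized mechanism for the multi-agent
unit-demand instance: `x v` is the allocation-probability matrix (a convex
combination of indicator vectors of matchings) and `pay v i ≥ 0` is agent
`i`'s payment. -/
structure IsRandMech (n m : ℕ) (k : Fin m → ℕ)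
    (x : (Fin n → Fin m → ℝ) → Fin n → Fin m → ℝ)
    (pay : (Fin n → Fin m → ℝ) → Fin n → ℝ) : Prop where
  feas : ∀ v, x v ∈ convexHull ℝ {χ : Fin n → Fin m → ℝ |
    ∃ S : Finset (Fin n × Fin m), IsMatching n m k S ∧
      χ = fun i j => if (i, j) ∈ S then 1 else 0}
  measX : ∀ i j, Measurable fun v => x v i j
  measPay : ∀ i : Fin n, Measurable fun v => pay v i
  pay_nonneg : ∀ v i, 0 ≤ pay v i
  ic : ∀ v : Fin n → Fin m → ℝ, (∀ i j, 0 ≤ v i j) →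
    ∀ (i : Fin n) (w : Fin m → ℝ), (∀ j, 0 ≤ w j) →
      (∑ j, x (Function.update v i w) i j * v i j)
          - pay (Function.update v i w) i
        ≤ (∑ j, x v i j * v i j) - pay v i
  ir : ∀ v : Fin n → Fin m → ℝ, (∀ i j, 0 ≤ v i j) → ∀ i : Fin n,
    0 ≤ (∑ j, x v i j * v i j) - pay v i

/-- A mechanism is deterministic if at every valuation matrix its allocation
is the indicator vector of a single matching. -/
def IsDeterministic (n m : ℕ) (k : Fin m → ℕ)
    (x : (Fin n → Fin m → ℝ) → Fin n → Fin m → ℝ) : Prop :=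
  ∀ v, ∃ S : Finset (Fin n × Fin m), IsMatching n m k S ∧
    x v = fun i j => if (i, j) ∈ S then 1 else 0

/-- Expected revenue of a multi-agent mechanism. -/
noncomputable def mechRevenue {n m : ℕ} (F : Fin n → Fin m → Measure ℝ)
    (pay : (Fin n → Fin m → ℝ) → Fin n → ℝ) : ℝ :=
  ∫ v, ∑ i : Fin n, pay v i ∂(valMeasure F)

section

open MeasureTheory Set
open scoped ENNReal NNReal

/-- Resampling one coordinate preserves a product probability measure. -/
lemma measurePreserving_update {ι α : Type*} [Fintype ι] [DecidableEq ι] [MeasurableSpace α]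
    (μ : ι → Measure α) [∀ i, IsProbabilityMeasure (μ i)] (i : ι) :
    MeasurePreserving (fun q : (ι → α) × α => Function.update q.1 i q.2)
      ((Measure.pi μ).prod (μ i)) (Measure.pi μ) := by
  have hm : Measurable (fun q : (ι → α) × α => Function.update q.1 i q.2) :=
    measurable_update'.comp measurable_id
  refine ⟨hm, ?_⟩
  refine (Measure.pi_eq fun s hs => ?_).symm
  rw [Measure.map_apply hm (MeasurableSet.univ_pi hs)]
  have : (fun q : (ι → α) × α => Function.update q.1 i q.2) ⁻¹' (univ.pi s)
      = (univ.pi (Function.update s i univ)) ×ˢ (s i) := by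
    ext ⟨v, w⟩
    simp only [mem_preimage, mem_pi, mem_univ, true_implies, mem_prod]
    constructor
    · intro h
      refine ⟨fun l => ?_, by simpa using h i⟩
      by_cases hl : l = i
      · subst hl; simp
      · simpa [hl] using h l
    · rintro ⟨h, h'⟩ l
      by_cases hl : l = i
      · subst hl; simpa using h'
      · simpa [hl] using h l
  rw [this, Measure.prod_prod, Measure.pi_pi, ← Finset.prod_erase_mul _ _ (Finset.mem_univ i),
    ← Finset.prod_erase_mul (Finset.univ) (fun l => μ l (s l)) (Finset.mem_univ i)]
  simp only [Function.update_self, measure_univ, mul_one]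
  congr 1
  refine Finset.prod_congr rfl fun l hl => ?_
  rw [Function.update_of_ne (Finset.ne_of_mem_erase hl)]

lemma lintegral_pi_resample {ι α : Type*} [Fintype ι] [DecidableEq ι] [MeasurableSpace α]
    (μ : ι → Measure α) [∀ i, IsProbabilityMeasure (μ i)] (i : ι) {f : (ι → α) → ℝ≥0∞}
    (hf : Measurable f) :
    ∫⁻ v, f v ∂(Measure.pi μ)
      = ∫⁻ v, ∫⁻ w, f (Function.update v i w) ∂(μ i) ∂(Measure.pi μ) := by
  rw [← (measurePreserving_update μ i).lintegral_comp hf]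
  exact lintegral_prod _ (hf.comp (measurePreserving_update μ i).measurable).aemeasurable

lemma measurePreserving_pi_prod {ι α β γ : Type*} [Fintype ι] [MeasurableSpace α]
    [MeasurableSpace β] [MeasurableSpace γ] (μ : ι → Measure α) (ν : ι → Measure β)
    (ρ : ι → Measure γ) [∀ i, IsProbabilityMeasure (μ i)] [∀ i, IsProbabilityMeasure (ν i)]
    [∀ i, IsProbabilityMeasure (ρ i)] (f : ι → α × β → γ)
    (hf : ∀ i, MeasurePreserving (f i) ((μ i).prod (ν i)) (ρ i)) :
    MeasurePreserving (fun q : (ι → α) × (ι → β) => fun i => f i (q.1 i, q.2 i))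
      ((Measure.pi μ).prod (Measure.pi ν)) (Measure.pi ρ) := by
  have h1 := (measurePreserving_arrowProdEquivProdArrow α β ι μ ν).symm
  exact (measurePreserving_pi (fun i => (μ i).prod (ν i)) ρ hf).comp h1

/-- A function with a subgradient in `[0, 1]` grows by exactly the integral of
the subgradient. -/
lemma integral_subgradient_eq (x u : ℝ → ℝ) (hx0 : ∀ s, 0 ≤ x s) (hx1 : ∀ s, x s ≤ 1)
    (hic : ∀ s ≥ 0, ∀ s' ≥ 0, u s + x s * (s' - s) ≤ u s') {a b : ℝ} (ha : 0 ≤ a)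
    (hab : a ≤ b) : ∫ t in a..b, x t = u b - u a := by
  have hlip : LipschitzOnWith 1 u (uIcc a b) := by
    refine LipschitzOnWith.of_le_add_mul 1 fun s hs t ht => ?_
    rw [uIcc_of_le hab] at hs ht
    have h1 := hic s (ha.trans hs.1) t (ha.trans ht.1)
    rw [Real.dist_eq]
    have h2 : x s * (s - t) ≤ |s - t| := by
      calc x s * (s - t) ≤ |x s * (s - t)| := le_abs_self _
        _ = x s * |s - t| := by rw [abs_mul, abs_of_nonneg (hx0 s)]
        _ ≤ 1 * |s - t| := by gcongr; exact hx1 s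
        _ = _ := one_mul _
    have h3 : x s * (t - s) = - (x s * (s - t)) := by ring
    simp only [NNReal.coe_one, one_mul]
    linarith
  rw [← hlip.absolutelyContinuousOnInterval.integral_deriv_eq_sub]
  refine intervalIntegral.integral_congr_ae ?_
  have hd := hlip.ae_differentiableWithinAt (μ := volume) measurableSet_uIcc
  rw [ae_restrict_iff' measurableSet_uIcc] at hd
  have hb : ∀ᵐ t : ℝ, t ≠ b := by simp [ae_iff]
  filter_upwards [hd, hb] with t ht htb htab
  have htu : t ∈ uIcc a b := uIoc_subset_uIcc htab
  rw [uIoc_of_le hab] at htab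
  have hnh : uIcc a b ∈ nhds t := by
    rw [uIcc_of_le hab]; exact Icc_mem_nhds htab.1 (lt_of_le_of_ne htab.2 htb)
  have hdu := ((ht htu).differentiableAt hnh).hasDerivAt
  have hg : HasDerivAt (fun s => u s - x t * (s - t)) (deriv u t - x t * 1) t :=
    hdu.sub (((hasDerivAt_id t).sub_const t).const_mul (x t))
  have ht0 : 0 < t := ha.trans_lt htab.1
  have hmin : IsLocalMin (fun s => u s - x t * (s - t)) t := by
    filter_upwards [Ioi_mem_nhds ht0] with s hs
    have := hic t ht0.le s (le_of_lt hs)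
    simp only [sub_self, mul_zero]; linarith
  have := hmin.hasDerivAt_eq_zero hg
  linarith

/-- The revenue of a single-item, single-buyer mechanism (with allocation probability `x`,
indirect utility `u` and production cost `β`) is at most the best posted-price revenue. -/
lemma lintegral_virtual_le (μ : Measure ℝ) [IsProbabilityMeasure μ] {β R : ℝ} (hβ : 0 ≤ β)
    (hR : ∀ t ≥ β, (t - β) * μ.real (Ici t) ≤ R) (x u : ℝ → ℝ) (hx0 : ∀ s, 0 ≤ x s)
    (hx1 : ∀ s, x s ≤ 1) (hxm : Measurable x) (hu : ∀ s ≥ 0, 0 ≤ u s)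
    (hic : ∀ s ≥ 0, ∀ s' ≥ 0, u s + x s * (s' - s) ≤ u s') :
    ∫⁻ s in Ioi β, ENNReal.ofReal (x s * (s - β) - u s) ∂μ ≤ ENNReal.ofReal R := by
  have hmono : ∀ s ≥ 0, ∀ s', s ≤ s' → x s ≤ x s' := by
    intro s hs s' hss
    rcases hss.eq_or_lt with rfl | hlt
    · rfl
    have h1 := hic s hs s' (hs.le.trans hss)
    have h2 := hic s' (hs.le.trans hss) s hs
    have : 0 ≤ (x s' - x s) * (s' - s) := by nlinarith
    nlinarith [nonneg_of_mul_nonneg_left this (sub_pos.2 hlt)]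
  set L : ℝ → ℝ≥0∞ := fun θ => volume {τ | β < τ ∧ x τ < θ} with hL
  have hLm : Measurable L :=
    Monotone.measurable fun θ θ' h => measure_mono fun τ hτ => ⟨hτ.1, hτ.2.trans_le h⟩
  have key : ∀ s ∈ Ioi β, ENNReal.ofReal (x s * (s - β) - u s)
      ≤ ∫⁻ θ in Ioc 0 1, {θ | θ ≤ x s}.indicator L θ := by
    intro s hs
    have hs' : β ≤ s := le_of_lt hs
    have hintg : IntegrableOn x (Ioc β s) := by
      refine Measure.integrableOn_of_bounded (M := 1) (by simp) hxm.aestronglyMeasurable ?_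
      filter_upwards with t
      rw [Real.norm_of_nonneg (hx0 t)]; exact hx1 t
    have h1 : x s * (s - β) - u s ≤ ∫ τ in Ioc β s, (x s - x τ) := by
      rw [integral_sub (by simp) hintg, ← intervalIntegral.integral_of_le hs',
        ← intervalIntegral.integral_of_le hs', integral_subgradient_eq x u hx0 hx1 hic hβ hs']
      simp only [intervalIntegral.integral_const, smul_eq_mul]
      have := hu β hβ
      nlinarith
    refine (ENNReal.ofReal_le_ofReal h1).trans ?_
    rw [ofReal_integral_eq_lintegral_ofReal]
    rotate_left
    · exact Integrable.sub (by simp) hintg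
    · rw [Filter.EventuallyLE, ae_restrict_iff' measurableSet_Ioc]
      filter_upwards with τ hτ
      exact sub_nonneg.2 (hmono τ (hβ.trans hτ.1.le) s hτ.2)
    have h2 : ∀ τ, ENNReal.ofReal (x s - x τ)
        = ∫⁻ θ in Ioc 0 1, {q : ℝ × ℝ | x q.1 < q.2 ∧ q.2 ≤ x s}.indicator 1 (τ, θ) := by
      intro τ
      rw [← Real.volume_Ioc, ← lintegral_indicator_one measurableSet_Ioc,
        ← lintegral_indicator measurableSet_Ioc]
      congr 1
      ext θ
      by_cases h : x τ < θ ∧ θ ≤ x s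
      · have : θ ∈ Ioc (0:ℝ) 1 := ⟨(hx0 τ).trans_lt h.1, h.2.trans (hx1 s)⟩
        simp [indicator, h, this.1, this.2]
      · simp [indicator, h]
    simp_rw [h2]
    have hset : MeasurableSet {q : ℝ × ℝ | x q.1 < q.2 ∧ q.2 ≤ x s} :=
      (measurableSet_lt (hxm.comp measurable_fst) measurable_snd).inter
        (measurableSet_le measurable_snd measurable_const)
    rw [lintegral_lintegral_swap (by
      exact (measurable_one.indicator hset).aemeasurable)]
    refine lintegral_mono fun θ => ?_
    by_cases hθ : θ ≤ x s
    · rw [indicator_of_mem (by exact hθ)]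
      have : ∀ τ, {q : ℝ × ℝ | x q.1 < q.2 ∧ q.2 ≤ x s}.indicator (1 : ℝ × ℝ → ℝ≥0∞) (τ, θ)
          = {τ | x τ < θ}.indicator 1 τ := by
        intro τ; simp [indicator, hθ]
      simp_rw [this]
      rw [lintegral_indicator_one (measurableSet_lt hxm measurable_const),
        Measure.restrict_apply (measurableSet_lt hxm measurable_const)]
      exact measure_mono fun τ hτ => ⟨hτ.2.1, hτ.1⟩
    · simp [indicator, hθ]
  have hset : MeasurableSet {q : ℝ × ℝ | q.2 ≤ x q.1} :=
    measurableSet_le measurable_snd (hxm.comp measurable_fst)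
  calc ∫⁻ s in Ioi β, ENNReal.ofReal (x s * (s - β) - u s) ∂μ
      ≤ ∫⁻ s in Ioi β, ∫⁻ θ in Ioc 0 1, {θ | θ ≤ x s}.indicator L θ ∂volume ∂μ :=
        setLIntegral_mono' measurableSet_Ioi key
    _ = ∫⁻ θ in Ioc 0 1, ∫⁻ s in Ioi β, {θ | θ ≤ x s}.indicator L θ ∂μ := by
        refine lintegral_lintegral_swap ?_
        have : Function.uncurry (fun s θ => {θ | θ ≤ x s}.indicator L θ)
            = {q : ℝ × ℝ | q.2 ≤ x q.1}.indicator (fun q => L q.2) := by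
          ext ⟨s, θ⟩; simp [indicator]
        rw [this]
        exact ((hLm.comp measurable_snd).indicator hset).aemeasurable
    _ ≤ ∫⁻ θ in Ioc (0:ℝ) 1, ENNReal.ofReal R := by
        refine lintegral_mono fun θ => ?_
        have hms : MeasurableSet {s | θ ≤ x s} := measurableSet_le measurable_const hxm
        have : ∀ s, {θ | θ ≤ x s}.indicator L θ = {s | θ ≤ x s}.indicator (fun _ => L θ) s := by
          intro s; simp [indicator]
        simp_rw [this]
        rw [lintegral_indicator_const hms, Measure.restrict_apply hms]
        by_cases hem : ∃ s, θ ≤ x s ∧ β < s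
        · obtain ⟨s₀, h₀, hb₀⟩ := hem
          have hbd : ∀ s, θ ≤ x s → β < s → L θ ≤ ENNReal.ofReal (s - β) := by
            intro s h hb
            rw [← Real.volume_Ioo]
            refine measure_mono fun τ hτ => ⟨hτ.1, ?_⟩
            by_contra hcon
            exact absurd (h.trans (hmono s (hβ.trans hb.le) τ (not_lt.1 hcon))) (not_le.2 hτ.2)
          have hfin : L θ ≠ ∞ := ne_top_of_le_ne_top ENNReal.ofReal_ne_top (hbd s₀ h₀ hb₀)
          have hsub : {s | θ ≤ x s} ∩ Ioi β ⊆ Ici (β + (L θ).toReal) := by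
            intro s hs
            have := ENNReal.toReal_le_of_le_ofReal (sub_nonneg.2 (le_of_lt hs.2))
              (hbd s hs.1 hs.2)
            rw [mem_Ici]; linarith
          calc L θ * μ ({s | θ ≤ x s} ∩ Ioi β) ≤ L θ * μ (Ici (β + (L θ).toReal)) := by gcongr
            _ = ENNReal.ofReal ((L θ).toReal * μ.real (Ici (β + (L θ).toReal))) := by
                rw [ENNReal.ofReal_mul ENNReal.toReal_nonneg, ENNReal.ofReal_toReal hfin,
                  ofReal_measureReal]
            _ ≤ ENNReal.ofReal R := by
                refine ENNReal.ofReal_le_ofReal ?_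
                have := hR (β + (L θ).toReal) (by linarith [ENNReal.toReal_nonneg (a := L θ)])
                simpa using this
        · have : {s | θ ≤ x s} ∩ Ioi β = ∅ := by
            ext s; simp only [mem_inter_iff, mem_ofPred_eq, mem_Ioi, mem_empty_iff_false, iff_false]
            exact fun h => hem ⟨s, h⟩
          simp [this]
    _ = ENNReal.ofReal R := by simp

lemma measurable_finset_sup {ι α : Type*} [MeasurableSpace α] (s : Finset ι) {f : ι → α → ℝ≥0}
    (hf : ∀ i ∈ s, Measurable (f i)) : Measurable fun a => s.sup fun i => f i a := by
  classical
  induction s using Finset.induction_on with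
  | empty => simp
  | insert i s _ ih =>
    simp only [Finset.sup_insert]
    exact (hf i (by simp)).sup (ih fun l hl => hf l (by simp [hl]))

lemma ae_nonneg_pi {ι : Type*} [Fintype ι] (G : ι → Measure ℝ) [∀ j, IsProbabilityMeasure (G j)]
    (hG : ∀ j, G j (Iio 0) = 0) : ∀ᵐ w ∂(Measure.pi G), ∀ j, 0 ≤ w j := by
  rw [ae_all_iff]
  intro j
  have h : ∀ᵐ s ∂(G j), 0 ≤ s := by
    rw [ae_iff]; simpa [Iio] using hG j
  exact (Measure.quasiMeasurePreserving_eval G j).ae h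

/-- The revenue of an agent facing a menu of lotteries is at most what it would pay at prices `β`
for its allocation, plus twice the best posted-price profits at production costs `β`. -/
lemma single_agent_le {m : ℕ} (G : Fin m → Measure ℝ) [∀ j, IsProbabilityMeasure (G j)]
    (hG : ∀ j, G j (Iio 0) = 0) (β R : Fin m → ℝ) (hβ : ∀ j, 0 ≤ β j)
    (hR : ∀ j, ∀ t ≥ β j, (t - β j) * (G j).real (Ici t) ≤ R j)
    (X : (Fin m → ℝ) → Fin m → ℝ) (P : (Fin m → ℝ) → ℝ)
    (hXm : ∀ j, Measurable fun w => X w j) (hPm : Measurable P)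
    (hX0 : ∀ w j, 0 ≤ X w j) (hX1 : ∀ w, ∑ j, X w j ≤ 1)
    (hic : ∀ w, (∀ j, 0 ≤ w j) → ∀ w', (∀ j, 0 ≤ w' j) →
      ∑ j, X w' j * w j - P w' ≤ ∑ j, X w j * w j - P w)
    (hir : ∀ w, (∀ j, 0 ≤ w j) → 0 ≤ ∑ j, X w j * w j - P w) :
    ∫⁻ w, ENNReal.ofReal (P w) ∂(Measure.pi G) ≤
      ∑ j, ENNReal.ofReal (β j) * ∫⁻ w, ENNReal.ofReal (X w j) ∂(Measure.pi G)
        + ∑ j, 2 * ENNReal.ofReal (R j) := by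
  set U : (Fin m → ℝ) → ℝ := fun w => ∑ j, X w j * w j - P w with hU
  have hUm : Measurable U :=
    (Finset.measurable_sum _ fun j _ => (hXm j).mul (measurable_pi_apply j)).sub hPm
  have hXle : ∀ w j, X w j ≤ 1 := fun w j =>
    (Finset.single_le_sum (fun l _ => hX0 w l) (Finset.mem_univ j)).trans (hX1 w)
  set T : Fin m → (Fin m → ℝ) → ℝ≥0 := fun j w =>
    (Finset.univ.erase j).sup fun l => (w l - β l).toNNReal with hT
  have hTm : ∀ j, Measurable (T j) := fun j =>
    measurable_finset_sup _ fun l _ => ((measurable_pi_apply l).sub_const _).real_toNNReal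
  set A : Fin m → (Fin m → ℝ) → ℝ≥0∞ := fun j => {w | β j < w j}.indicator
    fun w => ENNReal.ofReal (X w j * (w j - β j) - U w) with hA
  have hAm : ∀ j, Measurable (A j) := fun j =>
    (((hXm j).mul ((measurable_pi_apply j).sub_const _)).sub hUm).ennreal_ofReal.indicator
      (measurableSet_lt measurable_const (measurable_pi_apply j))
  set C : Fin m → (Fin m → ℝ) → ℝ≥0∞ := fun j => {w | β j + T j w ≤ w j}.indicator
    fun w => (T j w : ℝ≥0∞) with hC
  have hCm : ∀ j, Measurable (C j) := fun j =>
    (hTm j).coe_nnreal_ennreal.indicator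
      (measurableSet_le ((hTm j).coe_nnreal_real.const_add _) (measurable_pi_apply j))
  have hae := ae_nonneg_pi G hG
  have hpt : ∀ᵐ w ∂(Measure.pi G), ENNReal.ofReal (P w) ≤
      ∑ j, ENNReal.ofReal (β j) * ENNReal.ofReal (X w j) + ∑ j, (A j w + C j w) := by
    filter_upwards [hae] with w hw
    have hsum : ∑ j, ENNReal.ofReal (β j) * ENNReal.ofReal (X w j)
        = ENNReal.ofReal (∑ j, β j * X w j) := by
      rw [ENNReal.ofReal_sum_of_nonneg fun j _ => mul_nonneg (hβ j) (hX0 w j)]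
      exact Finset.sum_congr rfl fun j _ => (ENNReal.ofReal_mul (hβ j)).symm
    rw [hsum]
    have hPeq : P w = ∑ j, β j * X w j + (∑ j, X w j * (w j - β j) - U w) := by
      have : ∑ j, X w j * (w j - β j) = ∑ j, X w j * w j - ∑ j, β j * X w j := by
        rw [← Finset.sum_sub_distrib]
        exact Finset.sum_congr rfl fun j _ => by ring
      rw [this, hU]; ring
    have hU0 : 0 ≤ U w := hir w hw
    by_cases hpos : ∃ j, 0 < w j - β j
    · obtain ⟨j₀, hj₀⟩ := hpos
      obtain ⟨j, -, hj⟩ := Finset.exists_max_image Finset.univ (fun l => w l - β l)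
        ⟨j₀, Finset.mem_univ _⟩
      have hzj : 0 < w j - β j := hj₀.trans_le (hj j₀ (Finset.mem_univ _))
      have hTle : (T j w : ℝ) ≤ w j - β j := by
        have : T j w ≤ (w j - β j).toNNReal :=
          Finset.sup_le fun l _ => Real.toNNReal_le_toNNReal (hj l (Finset.mem_univ l))
        have h2 : (T j w : ℝ) ≤ ((w j - β j).toNNReal : ℝ) := by exact_mod_cast this
        rwa [Real.coe_toNNReal _ hzj.le] at h2
      have hrest : ∑ l ∈ Finset.univ.erase j, X w l * (w l - β l) ≤ T j w := by
        calc ∑ l ∈ Finset.univ.erase j, X w l * (w l - β l)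
            ≤ ∑ l ∈ Finset.univ.erase j, X w l * (T j w) := by
              refine Finset.sum_le_sum fun l hl => mul_le_mul_of_nonneg_left ?_ (hX0 w l)
              refine (Real.le_coe_toNNReal _).trans ?_
              exact_mod_cast Finset.le_sup (f := fun l => (w l - β l).toNNReal) hl
          _ = (∑ l ∈ Finset.univ.erase j, X w l) * T j w := by rw [Finset.sum_mul]
          _ ≤ 1 * T j w := by
              refine mul_le_mul_of_nonneg_right ?_ (T j w).2
              exact (Finset.sum_le_sum_of_subset_of_nonneg (Finset.erase_subset _ _)
                fun l _ _ => hX0 w l).trans (hX1 w)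
          _ = T j w := one_mul _
      have hle : P w ≤ ∑ j, β j * X w j + ((X w j * (w j - β j) - U w) + T j w) := by
        rw [hPeq, ← Finset.add_sum_erase _ (fun l => X w l * (w l - β l)) (Finset.mem_univ j)]
        linarith
      have hAj : A j w = ENNReal.ofReal (X w j * (w j - β j) - U w) := by
        have : β j < w j := by linarith
        simp [hA, this]
      have hCj : C j w = ENNReal.ofReal (T j w) := by
        rw [ENNReal.ofReal_coe_nnreal]
        have : β j + T j w ≤ w j := by linarith
        simp [hC, this]
      calc ENNReal.ofReal (P w) ≤ _ := ENNReal.ofReal_le_ofReal hle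
        _ ≤ ENNReal.ofReal (∑ j, β j * X w j) + (A j w + C j w) := by
          rw [hAj, hCj]
          refine ENNReal.ofReal_add_le.trans ?_
          gcongr
          exact ENNReal.ofReal_add_le
        _ ≤ _ := by
          gcongr
          exact Finset.single_le_sum (f := fun j => A j w + C j w) (fun _ _ => zero_le)
            (Finset.mem_univ j)
    · push Not at hpos
      refine le_add_right (ENNReal.ofReal_le_ofReal ?_)
      have : ∑ j, X w j * (w j - β j) ≤ 0 :=
        Finset.sum_nonpos fun j _ => mul_nonpos_of_nonneg_of_nonpos (hX0 w j) (hpos j)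
      linarith
  have hAint : ∀ j, ∫⁻ w, A j w ∂(Measure.pi G) ≤ ENNReal.ofReal (R j) := by
    intro j
    rw [lintegral_pi_resample G j (hAm j)]
    refine (lintegral_mono_ae (g := fun _ => ENNReal.ofReal (R j)) ?_).trans (by simp)
    filter_upwards [hae] with v hv
    have hnn : ∀ s ≥ (0:ℝ), ∀ l, 0 ≤ Function.update v j s l := by
      intro s hs l
      by_cases hl : l = j
      · subst hl; simpa using hs
      · simpa [hl] using hv l
    have hup : Measurable fun s : ℝ => Function.update v j s := measurable_update v
    have := lintegral_virtual_le (G j) (hβ j) (hR j) (fun s => X (Function.update v j s) j)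
      (fun s => U (Function.update v j s)) (fun s => hX0 _ _) (fun s => hXle _ _)
      ((hXm j).comp hup) (fun s hs => hir _ (hnn s hs)) (by
        intro s hs s' hs'
        have := hic _ (hnn s' hs') _ (hnn s hs)
        refine le_trans (le_of_eq ?_) this
        simp only [hU]
        rw [← Finset.add_sum_erase _ (fun l => X (Function.update v j s) l *
            Function.update v j s l) (Finset.mem_univ j),
          ← Finset.add_sum_erase _ (fun l => X (Function.update v j s) l *
            Function.update v j s' l) (Finset.mem_univ j)]
        have : ∑ l ∈ Finset.univ.erase j, X (Function.update v j s) l * Function.update v j s l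
            = ∑ l ∈ Finset.univ.erase j, X (Function.update v j s) l *
                Function.update v j s' l := by
          refine Finset.sum_congr rfl fun l hl => ?_
          rw [Function.update_of_ne (Finset.ne_of_mem_erase hl),
            Function.update_of_ne (Finset.ne_of_mem_erase hl)]
        rw [this]
        simp only [Function.update_self]
        ring)
    rw [← lintegral_indicator measurableSet_Ioi] at this
    refine le_trans (le_of_eq (lintegral_congr fun s => ?_)) this
    simp [hA, indicator]
  have hCint : ∀ j, ∫⁻ w, C j w ∂(Measure.pi G) ≤ ENNReal.ofReal (R j) := by
    intro j
    rw [lintegral_pi_resample G j (hCm j)]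
    refine (lintegral_mono (g := fun _ => ENNReal.ofReal (R j)) fun v => ?_).trans (by simp)
    have hTu : ∀ s, T j (Function.update v j s) = T j v := by
      intro s
      refine Finset.sup_congr rfl fun l hl => ?_
      rw [Function.update_of_ne (Finset.ne_of_mem_erase hl)]
    have : ∀ s, C j (Function.update v j s)
        = (Ici (β j + T j v)).indicator (fun _ => (T j v : ℝ≥0∞)) s := by
      intro s; simp [hC, indicator, hTu]
    simp_rw [this]
    rw [lintegral_indicator_const measurableSet_Ici, ← ENNReal.ofReal_coe_nnreal,
      ← ofReal_measureReal, ← ENNReal.ofReal_mul (T j v).coe_nonneg]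
    refine ENNReal.ofReal_le_ofReal ?_
    simpa using hR j (β j + T j v) (by simp)
  have hACm : ∀ j, Measurable fun w => A j w + C j w := fun j => (hAm j).add (hCm j)
  calc ∫⁻ w, ENNReal.ofReal (P w) ∂(Measure.pi G)
      ≤ ∫⁻ w, (∑ j, ENNReal.ofReal (β j) * ENNReal.ofReal (X w j) + ∑ j, (A j w + C j w))
          ∂(Measure.pi G) := lintegral_mono_ae hpt
    _ = ∑ j, ENNReal.ofReal (β j) * ∫⁻ w, ENNReal.ofReal (X w j) ∂(Measure.pi G)
        + ∑ j, (∫⁻ w, A j w ∂(Measure.pi G) + ∫⁻ w, C j w ∂(Measure.pi G)) := by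
        rw [lintegral_add_right _ (Finset.measurable_fun_sum _ fun j _ => hACm j),
          lintegral_finsetSum _ fun j _ => (hXm j).ennreal_ofReal.const_mul _,
          lintegral_finsetSum _ fun j _ => hACm j]
        congr 1
        · exact Finset.sum_congr rfl fun j _ => lintegral_const_mul _ (hXm j).ennreal_ofReal
        · exact Finset.sum_congr rfl fun j _ => lintegral_add_left (hAm j) _
    _ ≤ _ := by
        gcongr with j
        rw [two_mul]
        exact add_le_add (hAint j) (hCint j)

open Classical in
/-- The items of `A` that a buyer with values `w` is happiest to buy at prices `p`. -/
noncomputable def demandSet {m : ℕ} (A : Finset (Fin m)) (p w : Fin m → ℝ) : Finset (Fin m) :=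
  A.filter fun j => p j ≤ w j ∧ ∀ l ∈ A, w l - p l ≤ w j - p j

/-- The purchase of a utility-maximizing buyer, ties being broken by index. -/
noncomputable def pick {m : ℕ} (A : Finset (Fin m)) (p w : Fin m → ℝ) : Option (Fin m) :=
  if h : (demandSet A p w).Nonempty then some ((demandSet A p w).min' h) else none

/-- The number of units of each item sold to the first `t` agents by sequential posted pricing. -/
noncomputable def sold {n m : ℕ} (k : Fin m → ℕ) (p a : Fin n → Fin m → ℝ) : ℕ → Fin m → ℕ
  | 0 => fun _ => 0
  | t + 1 => fun j => sold k p a t j +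
      if h : t < n then
        if pick (Finset.univ.filter fun l => sold k p a t l < k l) (p ⟨t, h⟩) (a ⟨t, h⟩) = some j
        then 1 else 0
      else 0

/-- The purchase of agent `i` under sequential posted pricing. -/
noncomputable def purchase {n m : ℕ} (k : Fin m → ℕ) (p a : Fin n → Fin m → ℝ) (i : Fin n) :
    Option (Fin m) :=
  pick (Finset.univ.filter fun l => sold k p a i l < k l) (p i) (a i)

section pick

variable {m : ℕ} {A : Finset (Fin m)} {p w : Fin m → ℝ} {j : Fin m}

lemma mem_demandSet :
    j ∈ demandSet A p w ↔ j ∈ A ∧ p j ≤ w j ∧ ∀ l ∈ A, w l - p l ≤ w j - p j := by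
  simp [demandSet]

lemma mem_demandSet_of_pick_eq_some (h : pick A p w = some j) : j ∈ demandSet A p w := by
  unfold pick at h
  split_ifs at h with hne
  rw [← Option.some.inj h]
  exact Finset.min'_mem _ _

lemma exists_pick_eq_some (hj : j ∈ A) (hp : p j ≤ w j) : ∃ l, pick A p w = some l := by
  obtain ⟨l, hl, hmax⟩ := Finset.exists_max_image A (fun l => w l - p l) ⟨j, hj⟩
  have : (demandSet A p w).Nonempty :=
    ⟨l, mem_demandSet.2 ⟨hl, by linarith [hmax j hj], hmax⟩⟩
  exact ⟨_, dif_pos this⟩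

lemma pick_eq_some_of_unique (hj : j ∈ A) (hp : p j ≤ w j) (h : ∀ l ≠ j, w l < p l) :
    pick A p w = some j := by
  obtain ⟨l, hl⟩ := exists_pick_eq_some hj hp
  have := (mem_demandSet.1 (mem_demandSet_of_pick_eq_some hl)).2.1
  by_cases hlj : l = j
  · rw [hl, hlj]
  · exact absurd (h l hlj) (not_lt.2 this)

lemma measurableSet_pick_eq_some (A : Finset (Fin m)) (p : Fin m → ℝ) (j : Fin m) :
    MeasurableSet {w | pick A p w = some j} := by
  have hmem : ∀ l, MeasurableSet {w | l ∈ demandSet A p w} := by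
    intro l
    simp only [mem_demandSet]
    measurability
  have hS : ∀ S, MeasurableSet {w | demandSet A p w = S} := by
    intro S
    simp only [Finset.ext_iff]
    rw [ofPred_forall]
    refine MeasurableSet.iInter fun l => ?_
    by_cases hl : l ∈ S
    · simpa [hl] using hmem l
    · simp only [hl, iff_false]
      exact (hmem l).compl
  have : {w | pick A p w = some j} = ⋃ S ∈ {S : Finset (Fin m) |
      (if h : S.Nonempty then some (S.min' h) else none) = some j},
      {w | demandSet A p w = S} := by
    ext w
    simp [pick]
  rw [this]
  exact MeasurableSet.biUnion (Set.to_countable _) fun S _ => hS S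

end pick

section sold

variable {n m : ℕ} (k : Fin m → ℕ) (p a : Fin n → Fin m → ℝ)

lemma sold_update (i : Fin n) (w : Fin m → ℝ) (t : ℕ) (ht : t ≤ i) :
    sold k p (Function.update a i w) t = sold k p a t := by
  induction t with
  | zero => rfl
  | succ t ih =>
    have hne : ∀ h : t < n, (⟨t, h⟩ : Fin n) ≠ i := by
      rintro h rfl; simp at ht
    funext j
    simp only [sold]
    rw [ih (by omega)]
    by_cases h : t < n
    · simp only [h, dite_true]
      rw [Function.update_of_ne (hne h)]
    · simp only [h, dite_false]

lemma sold_succ (i : Fin n) (j : Fin m) :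
    sold k p a (i + 1) j = sold k p a i j + if purchase k p a i = some j then 1 else 0 := by
  simp only [sold, purchase, i.2, dite_true]
  rfl

lemma sold_le (t : ℕ) (j : Fin m) : sold k p a t j ≤ k j := by
  induction t with
  | zero => simp [sold]
  | succ t ih =>
    by_cases h : t < n
    · rw [sold_succ k p a ⟨t, h⟩ j]
      simp only
      split_ifs with hp
      · have := (mem_demandSet.1 (mem_demandSet_of_pick_eq_some hp)).1
        simp only [Finset.mem_filter, Finset.mem_univ, true_and] at this
        omega
      · simpa using ih
    · simpa [sold, h] using ih

lemma sold_eq_card (t : ℕ) (j : Fin m) :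
    sold k p a t j
      = (Finset.univ.filter fun i : Fin n => i < t ∧ purchase k p a i = some j).card := by
  induction t with
  | zero => simp [sold]
  | succ t ih =>
    by_cases h : t < n
    · rw [sold_succ k p a ⟨t, h⟩ j]
      simp only
      rw [ih]
      have hlt : ∀ i : Fin n, (i : ℕ) < t + 1 ↔ (i : ℕ) < t ∨ i = ⟨t, h⟩ := by
        intro i; rw [Fin.ext_iff]; simp only; omega
      simp only [hlt, or_and_right, Finset.filter_or]
      rw [Finset.card_union_of_disjoint]
      · congr 1
        split_ifs with hp
        · rw [eq_comm, Finset.card_eq_one]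
          refine ⟨⟨t, h⟩, ?_⟩
          ext i; simp only [Finset.mem_filter, Finset.mem_univ, true_and, Finset.mem_singleton]
          exact ⟨fun hi => hi.1, fun hi => ⟨hi, hi ▸ hp⟩⟩
        · rw [eq_comm, Finset.card_eq_zero, Finset.filter_eq_empty_iff]
          rintro i - ⟨rfl, hi⟩
          exact hp hi
      · rw [Finset.disjoint_filter]
        rintro i - ⟨hi, -⟩ ⟨rfl, -⟩
        simp at hi
    · have : ∀ i : Fin n, (i : ℕ) < t + 1 ↔ (i : ℕ) < t := by intro i; omega
      simp only [this, sold, h, dite_false, add_zero, ih]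

lemma sold_le_card (t : ℕ) (j : Fin m) :
    sold k p a t j ≤ (Finset.univ.filter fun i : Fin n => p i j ≤ a i j).card := by
  rw [sold_eq_card]
  refine Finset.card_le_card fun i hi => ?_
  simp only [Finset.mem_filter, Finset.mem_univ, true_and] at hi ⊢
  exact (mem_demandSet.1 (mem_demandSet_of_pick_eq_some hi.2)).2.1

lemma isMatching_purchase (k : Fin m → ℕ) (p a : Fin n → Fin m → ℝ) :
    IsMatching n m k (Finset.univ.filter fun e => purchase k p a e.1 = some e.2) := by
  constructor
  · intro i
    rw [Finset.card_le_one]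
    rintro ⟨i₁, j₁⟩ h₁ ⟨i₂, j₂⟩ h₂
    simp only [Finset.mem_filter, Finset.mem_univ, true_and] at h₁ h₂
    obtain ⟨h₁, rfl⟩ := h₁
    obtain ⟨h₂, rfl⟩ := h₂
    rw [h₁] at h₂
    rw [Option.some.inj h₂]
  · intro j
    refine le_trans ?_ (sold_le k p a n j)
    rw [sold_eq_card]
    refine Finset.card_le_card_of_injOn Prod.fst ?_ ?_
    · rintro ⟨i, l⟩ h
      simp only [Finset.coe_filter, Finset.mem_filter, Finset.mem_univ, true_and,
        mem_ofPred_eq] at h ⊢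
      exact ⟨i.2, h.2 ▸ h.1⟩
    · rintro ⟨i₁, j₁⟩ h₁ ⟨i₂, j₂⟩ h₂ h
      simp only [Finset.coe_filter, Finset.mem_filter, Finset.mem_univ, true_and,
        mem_ofPred_eq] at h₁ h₂ h
      rw [h, h₁.2, h₂.2]

lemma measurable_sold_and_measurableSet_purchase (k : Fin m → ℕ) (p : Fin n → Fin m → ℝ) (t : ℕ) :
    (∀ j, Measurable fun a => sold k p a t j) ∧ ∀ (h : t < n) j,
      MeasurableSet {a | purchase k p a ⟨t, h⟩ = some j} := by
  have step : ∀ t, (∀ j, Measurable fun a => sold k p a t j) → ∀ (h : t < n) j,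
      MeasurableSet {a | purchase k p a ⟨t, h⟩ = some j} := by
    intro t hs h j
    have : {a | purchase k p a ⟨t, h⟩ = some j} = ⋃ A : Finset (Fin m),
        {a | (Finset.univ.filter fun l => sold k p a t l < k l) = A} ∩
          (fun a : Fin n → Fin m → ℝ => a ⟨t, h⟩) ⁻¹' {w | pick A (p ⟨t, h⟩) w = some j} := by
      ext a
      simp [purchase]
    rw [this]
    refine MeasurableSet.iUnion fun A => MeasurableSet.inter ?_
      (measurable_pi_apply _ (measurableSet_pick_eq_some _ _ _))
    simp only [Finset.ext_iff, Finset.mem_filter, Finset.mem_univ, true_and]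
    rw [ofPred_forall]
    refine MeasurableSet.iInter fun l => ?_
    have hl := measurableSet_lt (hs l) (measurable_const (a := k l))
    by_cases hA : l ∈ A
    · simpa [hA] using hl
    · simp only [hA, iff_false]
      exact hl.compl
  have main : ∀ j, Measurable fun a => sold k p a t j := by
    induction t with
    | zero => intro j; simp only [sold]; exact measurable_const
    | succ t ih =>
      intro j
      by_cases h : t < n
      · have := fun a => sold_succ k p a ⟨t, h⟩ j
        simp only at this
        simp only [this]
        exact (ih j).add (Measurable.ite (step t ih h j) measurable_const measurable_const)
      · simpa [sold, h] using ih j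
  exact ⟨main, step t main⟩

lemma measurableSet_purchase (k : Fin m → ℕ) (p : Fin n → Fin m → ℝ) (i : Fin n) (j : Fin m) :
    MeasurableSet {a | purchase k p a i = some j} :=
  (measurable_sold_and_measurableSet_purchase k p i).2 i.2 j

end sold

lemma one_sub_sum_le_prod_one_sub {ι : Type*} (s : Finset ι) (f : ι → ℝ) (h0 : ∀ i, 0 ≤ f i)
    (h1 : ∀ i, f i ≤ 1) : 1 - ∑ i ∈ s, f i ≤ ∏ i ∈ s, (1 - f i) := by
  classical
  induction s using Finset.induction_on with
  | empty => simp
  | insert i s hi ih =>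
    rw [Finset.sum_insert hi, Finset.prod_insert hi]
    have := mul_le_mul_of_nonneg_left ih (sub_nonneg.2 (h1 i))
    nlinarith [h0 i, Finset.sum_nonneg fun l (_ : l ∈ s) => h0 l]

/-- An event not depending on a coordinate is independent of that coordinate. -/
lemma measureReal_pi_inter_eval {ι α : Type*} [Fintype ι] [DecidableEq ι] [MeasurableSpace α]
    (μ : ι → Measure α) [∀ i, IsProbabilityMeasure (μ i)] (i : ι) {E : Set (ι → α)} {H : Set α}
    (hE : MeasurableSet E) (hH : MeasurableSet H)
    (hEi : ∀ a w, Function.update a i w ∈ E ↔ a ∈ E) :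
    (Measure.pi μ).real (E ∩ Function.eval i ⁻¹' H) = (Measure.pi μ).real E * (μ i).real H := by
  have hm := measurePreserving_update μ i
  rw [← hm.measureReal_preimage
    (hE.inter (measurable_pi_apply i hH)).nullMeasurableSet, ← measureReal_prod_prod]
  congr 1
  ext ⟨a, w⟩
  simp [hEi]

lemma measurePreserving_eval_eval {n m : ℕ} (G : Fin n → Fin m → Measure ℝ)
    [∀ i j, IsProbabilityMeasure (G i j)] (i : Fin n) (j : Fin m) :
    MeasurePreserving (fun a : Fin n → Fin m → ℝ => a i j) (valMeasure G) (G i j) :=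
  (measurePreserving_eval (fun j => G i j) j).comp
    (measurePreserving_eval (fun i => Measure.pi fun j => G i j) i)

instance {n m : ℕ} (G : Fin n → Fin m → Measure ℝ) [∀ i j, IsProbabilityMeasure (G i j)] :
    IsProbabilityMeasure (valMeasure G) := by
  unfold valMeasure; infer_instance

section revenue

variable {n m : ℕ} {k : Fin m → ℕ} (G : Fin n → Fin m → Measure ℝ)
  [∀ i j, IsProbabilityMeasure (G i j)] {p : Fin n → Fin m → ℝ}

/-- By Markov's inequality an item is still available with probability at least `1 / 2`. -/
lemma half_le_measureReal_available (hk : ∀ j, 1 ≤ k j)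
    (hitem : ∀ j, ∑ i, (G i j).real (Ici (p i j)) ≤ k j / 2) (t : ℕ) (j : Fin m) :
    1 / 2 ≤ (valMeasure G).real {a | sold k p a t j < k j} := by
  have hms : MeasurableSet {a | sold k p a t j < k j} :=
    measurableSet_lt ((measurable_sold_and_measurableSet_purchase k p t).1 j) measurable_const
  have hev : ∀ i, MeasurableSet {a : Fin n → Fin m → ℝ | p i j ≤ a i j} := fun i =>
    measurableSet_le measurable_const ((measurable_pi_apply j).comp (measurable_pi_apply i))
  have hmk : (k j : ℝ) * (valMeasure G).real {a | sold k p a t j < k j}ᶜ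
      ≤ ∑ i, (G i j).real (Ici (p i j)) := by
    have h1 : ∀ i, (G i j).real (Ici (p i j))
        = ∫ a, {a : Fin n → Fin m → ℝ | p i j ≤ a i j}.indicator 1 a ∂(valMeasure G) := by
      intro i
      rw [integral_indicator_one (hev i), ← (measurePreserving_eval_eval G i j).measureReal_preimage
        measurableSet_Ici.nullMeasurableSet]
      rfl
    simp_rw [h1]
    have hI : ∀ s : Set (Fin n → Fin m → ℝ), MeasurableSet s →
        Integrable (s.indicator (1 : (Fin n → Fin m → ℝ) → ℝ)) (valMeasure G) := fun s hs =>
      (integrable_const (1:ℝ)).indicator hs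
    rw [← integral_finsetSum _ fun i _ => hI _ (hev i),
      ← integral_indicator_one hms.compl, ← integral_const_mul]
    refine integral_mono ((hI _ hms.compl).const_mul _)
      (integrable_finsetSum _ fun i _ => hI _ (hev i)) fun a => ?_
    have hcard : ∑ i, {a : Fin n → Fin m → ℝ | p i j ≤ a i j}.indicator
          (1 : (Fin n → Fin m → ℝ) → ℝ) a = ((Finset.univ.filter fun i : Fin n => p i j ≤ a i j).card : ℝ) := by
      simp [indicator]
    simp only
    rw [hcard]
    by_cases ha : sold k p a t j < k j
    · simp [ha]
    · rw [indicator_of_mem (by simpa using ha)]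
      simp only [Pi.one_apply, mul_one]
      exact_mod_cast (not_lt.1 ha).trans (sold_le_card k p a t j)
  rw [probReal_compl_eq_one_sub hms] at hmk
  have hkj : (1:ℝ) ≤ k j := by exact_mod_cast hk j
  have := hmk.trans (hitem j)
  by_contra hcon
  push Not at hcon
  nlinarith

/-- A single-agent bound: the agent wants item `j` and nothing else. -/
lemma half_mul_le_measureReal_box (i : Fin n) (j : Fin m)
    (hagent : ∑ j, (G i j).real (Ici (p i j)) ≤ 1 / 2) :
    (G i j).real (Ici (p i j)) * (1 / 2) ≤ (Measure.pi fun j => G i j).real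
      (univ.pi fun l => if l = j then Ici (p i l) else Iio (p i l)) := by
  have hy0 : ∀ l, 0 ≤ (G i l).real (Ici (p i l)) := fun l => measureReal_nonneg
  rw [measureReal_def (Measure.pi _), Measure.pi_pi, ENNReal.toReal_prod,
    ← Finset.mul_prod_erase _ _ (Finset.mem_univ j)]
  simp only [if_true]
  rw [← measureReal_def]
  refine mul_le_mul_of_nonneg_left ?_ (hy0 j)
  have h1 : ∏ l ∈ Finset.univ.erase j,
      ((G i l) (if l = j then Ici (p i l) else Iio (p i l))).toReal
      = ∏ l ∈ Finset.univ.erase j, (1 - (G i l).real (Ici (p i l))) := by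
    refine Finset.prod_congr rfl fun l hl => ?_
    rw [if_neg (Finset.ne_of_mem_erase hl), ← probReal_compl_eq_one_sub measurableSet_Ici,
      compl_Ici]
    rfl
  rw [h1]
  refine le_trans ?_ (one_sub_sum_le_prod_one_sub _ _ hy0 fun l => measureReal_le_one)
  have := Finset.sum_le_sum_of_subset_of_nonneg (Finset.erase_subset j Finset.univ)
    fun l _ _ => hy0 l
  linarith

/-- The expected revenue of sequential posted pricing. -/
lemma quarter_le_integral_purchase (hk : ∀ j, 1 ≤ k j) (hp : ∀ i j, 0 ≤ p i j)
    (hagent : ∀ i, ∑ j, (G i j).real (Ici (p i j)) ≤ 1 / 2)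
    (hitem : ∀ j, ∑ i, (G i j).real (Ici (p i j)) ≤ k j / 2) :
    1 / 4 * ∑ i, ∑ j, p i j * (G i j).real (Ici (p i j)) ≤
      ∫ a, ∑ i, ∑ j, (if purchase k p a i = some j then p i j else 0) ∂(valMeasure G) := by
  have hite : ∀ i j a, (if purchase k p a i = some j then p i j else 0)
      = {a | purchase k p a i = some j}.indicator (fun _ => p i j) a := by
    intro i j a; simp [indicator]
  have hintg : ∀ i j, Integrable (fun a => if purchase k p a i = some j then p i j else 0)
      (valMeasure G) := by
    intro i j
    simp_rw [hite]
    exact (integrable_const _).indicator (measurableSet_purchase k p i j)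
  rw [integral_finsetSum _ fun i _ => integrable_finsetSum _ fun j _ => hintg i j, Finset.mul_sum]
  refine Finset.sum_le_sum fun i _ => ?_
  rw [integral_finsetSum _ fun j _ => hintg i j, Finset.mul_sum]
  refine Finset.sum_le_sum fun j _ => ?_
  simp_rw [hite]
  rw [integral_indicator_const _ (measurableSet_purchase k p i j), smul_eq_mul]
  set E := {a | sold k p a i j < k j}
  set H : Set (Fin m → ℝ) := univ.pi fun l => if l = j then Ici (p i l) else Iio (p i l) with hH
  have hEm : MeasurableSet E :=
    measurableSet_lt ((measurable_sold_and_measurableSet_purchase k p i).1 j) measurable_const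
  have hHm : MeasurableSet H := MeasurableSet.univ_pi fun l => by
    split_ifs
    exacts [measurableSet_Ici, measurableSet_Iio]
  have hsub : E ∩ Function.eval i ⁻¹' H ⊆ {a | purchase k p a i = some j} := by
    rintro a ⟨haE, haH⟩
    have haH' : ∀ l, a i l ∈ if l = j then Ici (p i l) else Iio (p i l) := by
      simpa [hH] using haH
    refine pick_eq_some_of_unique (by simpa [E] using haE) (by simpa using haH' j) fun l hl => ?_
    simpa [hl] using haH' l
  have hprob : (valMeasure G).real (E ∩ Function.eval i ⁻¹' H)
      = (valMeasure G).real E * (Measure.pi fun j => G i j).real H :=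
    measureReal_pi_inter_eval (fun i => Measure.pi fun j => G i j) i hEm hHm fun a w => by
      simp only [E, mem_ofPred_eq, sold_update k p a i w i le_rfl]
  have h1 : 1 / 4 * (G i j).real (Ici (p i j))
      ≤ (valMeasure G).real {a | purchase k p a i = some j} := by
    refine le_trans ?_ (measureReal_mono hsub)
    rw [hprob]
    have hE := half_le_measureReal_available G hk hitem i j
    have hb := half_mul_le_measureReal_box G i j (hagent i)
    calc 1 / 4 * (G i j).real (Ici (p i j))
        = 1 / 2 * ((G i j).real (Ici (p i j)) * (1 / 2)) := by ring
      _ ≤ _ := mul_le_mul hE hb (by positivity) measureReal_nonneg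
  have := mul_le_mul_of_nonneg_left h1 (hp i j)
  linarith

end revenue

section pricing

variable {n m : ℕ}

/-- Withhold the items `j` with `b j = false` from a buyer with values `w`. -/
def maskRow {m : ℕ} (b : Fin m → Bool) (w : Fin m → ℝ) : Fin m → ℝ :=
  fun j => if b j then w j else -1

lemma measurable_maskRow (b : Fin m → Bool) : Measurable (maskRow b) := by
  refine measurable_pi_lambda _ fun j => ?_
  unfold maskRow
  cases b j
  · simp
  · simpa using measurable_pi_apply j

lemma maskRow_eq_of_pick_eq_some {A : Finset (Fin m)} {p : Fin m → ℝ} (hp : ∀ j, 0 ≤ p j)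
    {b : Fin m → Bool} {w : Fin m → ℝ} {j : Fin m} (h : pick A p (maskRow b w) = some j) :
    b j = true := by
  have h1 := (mem_demandSet.1 (mem_demandSet_of_pick_eq_some h)).2.1
  by_contra hb
  simp only [maskRow, hb] at h1
  have := hp j
  simp at h1
  linarith

lemma pick_utility_nonneg {A : Finset (Fin m)} {p : Fin m → ℝ} (hp : ∀ j, 0 ≤ p j)
    (b : Fin m → Bool) (w : Fin m → ℝ) :
    0 ≤ (pick A p (maskRow b w)).elim 0 fun j => w j - p j := by
  rcases h : pick A p (maskRow b w) with _ | j
  · simp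
  · have hb := maskRow_eq_of_pick_eq_some hp h
    have h1 := (mem_demandSet.1 (mem_demandSet_of_pick_eq_some h)).2.1
    simp only [maskRow, hb, if_true] at h1
    simpa using h1

lemma pick_utility_le {A : Finset (Fin m)} {p : Fin m → ℝ} (hp : ∀ j, 0 ≤ p j)
    (b : Fin m → Bool) (w w' : Fin m → ℝ) :
    ((pick A p (maskRow b w')).elim 0 fun j => w j - p j)
      ≤ (pick A p (maskRow b w)).elim 0 fun j => w j - p j := by
  rcases h' : pick A p (maskRow b w') with _ | l
  · exact pick_utility_nonneg hp b w
  have hbl := maskRow_eq_of_pick_eq_some hp h'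
  have hl := (mem_demandSet.1 (mem_demandSet_of_pick_eq_some h')).1
  by_cases hpl : p l ≤ w l
  · obtain ⟨j, hj⟩ := exists_pick_eq_some (w := maskRow b w) hl (by simpa [maskRow, hbl] using hpl)
    have h1 := (mem_demandSet.1 (mem_demandSet_of_pick_eq_some hj)).2.2 l hl
    simp only [maskRow, hbl, maskRow_eq_of_pick_eq_some hp hj, if_true] at h1
    simpa [hj] using h1
  · refine le_trans ?_ (pick_utility_nonneg hp b w)
    simp only [Option.elim_some]
    linarith

/-- Withhold the pairs `(i, j)` with `b i j = false`. -/
def mask (b : Fin n → Fin m → Bool) (v : Fin n → Fin m → ℝ) : Fin n → Fin m → ℝ :=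
  fun i => maskRow (b i) (v i)

lemma mask_update (b : Fin n → Fin m → Bool) (v : Fin n → Fin m → ℝ) (i : Fin n)
    (w : Fin m → ℝ) :
    mask b (Function.update v i w) = Function.update (mask b v) i (maskRow (b i) w) := by
  funext l
  by_cases h : l = i
  · subst h; simp [mask]
  · simp [mask, h]

/-- The payments of sequential posted pricing. -/
noncomputable def postedPay (k : Fin m → ℕ) (p a : Fin n → Fin m → ℝ) (i : Fin n) : ℝ :=
  ∑ j, if purchase k p a i = some j then p i j else 0

/-- The allocation of sequential posted pricing. -/
noncomputable def postedAlloc (k : Fin m → ℕ) (p a : Fin n → Fin m → ℝ) (i : Fin n) (j : Fin m) :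
    ℝ :=
  if purchase k p a i = some j then 1 else 0

lemma posted_utility (k : Fin m → ℕ) (p a : Fin n → Fin m → ℝ) (i : Fin n) (w : Fin m → ℝ) :
    (∑ j, postedAlloc k p a i j * w j) - postedPay k p a i
      = (purchase k p a i).elim 0 fun j => w j - p i j := by
  unfold postedAlloc postedPay
  cases purchase k p a i <;> simp

lemma measurable_postedPay (k : Fin m → ℕ) (p : Fin n → Fin m → ℝ) (i : Fin n) :
    Measurable fun a => postedPay k p a i :=
  Finset.measurable_fun_sum _ fun j _ =>
    Measurable.ite (measurableSet_purchase k p i j) measurable_const measurable_const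

lemma postedPay_nonneg (k : Fin m → ℕ) {p : Fin n → Fin m → ℝ} (hp : ∀ i j, 0 ≤ p i j)
    (a : Fin n → Fin m → ℝ) (i : Fin n) : 0 ≤ postedPay k p a i := by
  refine Finset.sum_nonneg fun j _ => ?_
  split_ifs
  exacts [hp i j, le_rfl]

lemma isDeterministic_postedAlloc (k : Fin m → ℕ) (p : Fin n → Fin m → ℝ)
    (b : Fin n → Fin m → Bool) :
    IsDeterministic n m k fun v => postedAlloc k p (mask b v) := fun v =>
  ⟨_, isMatching_purchase k p (mask b v), by funext i j; simp [postedAlloc]⟩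

lemma isRandMech_posted (k : Fin m → ℕ) {p : Fin n → Fin m → ℝ} (hp : ∀ i j, 0 ≤ p i j)
    (b : Fin n → Fin m → Bool) :
    IsRandMech n m k (fun v => postedAlloc k p (mask b v)) fun v => postedPay k p (mask b v) := by
  have hm : Measurable (mask b) := measurable_pi_lambda _ fun i =>
    (measurable_maskRow (b i)).comp (measurable_pi_apply i)
  refine ⟨fun v => subset_convexHull ℝ _ (isDeterministic_postedAlloc k p b v), fun i j => ?_,
    fun i => (measurable_postedPay k p i).comp hm, fun v => postedPay_nonneg k hp _,
    fun v _ i w _ => ?_, fun v _ i => ?_⟩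
  · exact (Measurable.ite (measurableSet_purchase k p i j) measurable_const
      measurable_const).comp hm
  · rw [posted_utility, posted_utility]
    simp only [purchase, mask_update]
    rw [sold_update k p _ i _ i le_rfl]
    simp only [Function.update_self]
    exact pick_utility_le (hp i) (b i) (v i) w
  · rw [posted_utility]
    exact pick_utility_nonneg (hp i) (b i) (v i)

lemma postedPay_le (k : Fin m → ℕ) {p : Fin n → Fin m → ℝ} (hp : ∀ i j, 0 ≤ p i j)
    (a : Fin n → Fin m → ℝ) (i : Fin n) : postedPay k p a i ≤ ∑ j, p i j := by
  refine Finset.sum_le_sum fun j _ => ?_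
  split_ifs
  exacts [le_rfl, hp i j]

lemma integrable_postedPay (G : Fin n → Fin m → Measure ℝ) [∀ i j, IsProbabilityMeasure (G i j)]
    (k : Fin m → ℕ) {p : Fin n → Fin m → ℝ} (hp : ∀ i j, 0 ≤ p i j) :
    Integrable (fun a => ∑ i, postedPay k p a i) (valMeasure G) := by
  refine integrable_finsetSum _ fun i _ =>
    Integrable.of_bound (measurable_postedPay k p i).aestronglyMeasurable (∑ j, p i j)
      (ae_of_all _ fun a => ?_)
  rw [Real.norm_of_nonneg (postedPay_nonneg k hp a i)]
  exact postedPay_le k hp a i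

/-- A biased coin. -/
noncomputable def coin (s : ℝ) : Measure Bool :=
  ENNReal.ofReal s • Measure.dirac true + ENNReal.ofReal (1 - s) • Measure.dirac false

lemma isProbabilityMeasure_coin {s : ℝ} (h0 : 0 ≤ s) (h1 : s ≤ 1) :
    IsProbabilityMeasure (coin s) := ⟨by
  simp [coin, ← ENNReal.ofReal_add h0 (sub_nonneg.2 h1)]⟩

/-- The distribution of a value `v ∼ μ` that is withheld with probability `1 - s`. -/
noncomputable def thin (μ : Measure ℝ) (s : ℝ) : Measure ℝ :=
  (μ.prod (coin s)).map fun q => if q.2 then q.1 else -1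

lemma measurable_thin : Measurable fun q : ℝ × Bool => if q.2 then q.1 else -1 :=
  Measurable.ite (measurable_snd (measurableSet_singleton true)) measurable_fst measurable_const

lemma thin_real_Ici (μ : Measure ℝ) [IsProbabilityMeasure μ] {s : ℝ} (h0 : 0 ≤ s) (h1 : s ≤ 1)
    {t : ℝ} (ht : 0 ≤ t) : (thin μ s).real (Ici t) = s * μ.real (Ici t) := by
  have := isProbabilityMeasure_coin h0 h1
  have hpre : (fun q : ℝ × Bool => if q.2 then q.1 else -1) ⁻¹' Ici t = Ici t ×ˢ {true} := by
    ext ⟨v, b⟩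
    cases b
    · simp; linarith
    · simp
  rw [thin, map_measureReal_apply measurable_thin measurableSet_Ici, hpre, measureReal_prod_prod,
    mul_comm]
  congr 1
  simp [coin, measureReal_def, ENNReal.toReal_ofReal h0]

/-- Some deterministic mechanism earns a quarter of the ex-ante posted-pricing revenue. -/
theorem exists_isDeterministic_quarter_le {k : Fin m → ℕ} (hk : ∀ j, 1 ≤ k j)
    (F : Fin n → Fin m → Measure ℝ) [∀ i j, IsProbabilityMeasure (F i j)]
    {p s : Fin n → Fin m → ℝ} (hp : ∀ i j, 0 ≤ p i j) (hs0 : ∀ i j, 0 ≤ s i j)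
    (hs1 : ∀ i j, s i j ≤ 1)
    (hagent : ∀ i, ∑ j, s i j * (F i j).real (Ici (p i j)) ≤ 1 / 2)
    (hitem : ∀ j, ∑ i, s i j * (F i j).real (Ici (p i j)) ≤ k j / 2) :
    ∃ x' pay', IsRandMech n m k x' pay' ∧ IsDeterministic n m k x' ∧
      1 / 4 * ∑ i, ∑ j, p i j * (s i j * (F i j).real (Ici (p i j))) ≤ mechRevenue F pay' := by
  have hcoin : ∀ i j, IsProbabilityMeasure (coin (s i j)) := fun i j =>
    isProbabilityMeasure_coin (hs0 i j) (hs1 i j)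
  have hthin : ∀ i j, IsProbabilityMeasure (thin (F i j) (s i j)) := fun i j =>
    Measure.isProbabilityMeasure_map measurable_thin.aemeasurable
  have hIci : ∀ i j, (thin (F i j) (s i j)).real (Ici (p i j))
      = s i j * (F i j).real (Ici (p i j)) := fun i j =>
    thin_real_Ici _ (hs0 i j) (hs1 i j) (hp i j)
  set B : Measure (Fin n → Fin m → Bool) := Measure.pi fun i => Measure.pi fun j => coin (s i j)
    with hB
  have hmp : MeasurePreserving (fun q : (Fin n → Fin m → ℝ) × (Fin n → Fin m → Bool) =>
      mask q.2 q.1) ((valMeasure F).prod B) (valMeasure fun i j => thin (F i j) (s i j)) := by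
    refine measurePreserving_pi_prod (fun i => Measure.pi fun j => F i j)
      (fun i => Measure.pi fun j => coin (s i j))
      (fun i => Measure.pi fun j => thin (F i j) (s i j))
      (fun _ q => maskRow q.2 q.1) fun i => ?_
    exact measurePreserving_pi_prod (fun j => F i j) (fun j => coin (s i j))
      (fun j => thin (F i j) (s i j)) (fun _ q => if q.2 then q.1 else -1)
      fun j => ⟨measurable_thin, rfl⟩
  have hquart := quarter_le_integral_purchase (k := k) (p := p)
    (fun i j => thin (F i j) (s i j)) hk hp
    (fun i => by simpa only [hIci] using hagent i) (fun j => by simpa only [hIci] using hitem j)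
  simp only [hIci] at hquart
  have hintg := hmp.integrable_comp_of_integrable
    (integrable_postedPay (fun i j => thin (F i j) (s i j)) k hp)
  have hF : ∫ b, ∫ v, ∑ i, postedPay k p (mask b v) i ∂(valMeasure F) ∂B
      = ∫ a, ∑ i, postedPay k p a i ∂(valMeasure fun i j => thin (F i j) (s i j)) := by
    rw [← hmp.map_eq, integral_map hmp.measurable.aemeasurable
      (Finset.measurable_fun_sum _ fun i _ =>
        measurable_postedPay k p i).aestronglyMeasurable]
    exact (integral_prod_symm _ hintg).symm
  have hfub : Integrable (fun b => ∫ v, ∑ i, postedPay k p (mask b v) i ∂(valMeasure F)) B :=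
    hintg.integral_prod_right
  obtain ⟨b, hb⟩ := exists_integral_le hfub
  refine ⟨_, _, isRandMech_posted k hp b, isDeterministic_postedAlloc k p b, ?_⟩
  refine (hquart.trans (le_of_eq ?_)).trans hb
  rw [hF]
  rfl

end pricing

section quantile

open ProbabilityTheory Filter Topology

/-- A nonnegative value exceeded with probability about `q`. -/
lemma exists_quantile (μ : Measure ℝ) [IsProbabilityMeasure μ] {q : ℝ} (hq : 0 < q) :
    ∃ β, 0 ≤ β ∧ μ.real (Ioi β) ≤ q ∧ (β = 0 ∨ q ≤ μ.real (Ici β)) := by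
  have hIoi : ∀ t, μ.real (Ioi t) = 1 - cdf μ t := by
    intro t
    rw [cdf_eq_real, ← compl_Iic, probReal_compl_eq_one_sub measurableSet_Iic]
  set S : Set ℝ := {t | 0 ≤ t ∧ 1 - q ≤ cdf μ t} with hS
  have hne : S.Nonempty := by
    have h1 := (tendsto_cdf_atTop μ).eventually (lt_mem_nhds (show 1 - q < 1 by linarith))
    obtain ⟨t, ht, ht0⟩ := (h1.and (eventually_ge_atTop 0)).exists
    exact ⟨t, ht0, ht.le⟩
  have hbdd : BddBelow S := ⟨0, fun t ht => ht.1⟩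
  have hβ : 0 ≤ sInf S := le_csInf hne fun t ht => ht.1
  refine ⟨sInf S, hβ, ?_, ?_⟩
  · have h1 : 1 - q ≤ cdf μ (sInf S) := by
      have hc := ((cdf μ).right_continuous (sInf S)).mono Ioi_subset_Ici_self
      refine ge_of_tendsto hc ?_
      filter_upwards [self_mem_nhdsWithin] with t ht
      obtain ⟨s, hs, hst⟩ := exists_lt_of_csInf_lt hne ht
      exact hs.2.trans ((cdf μ).mono hst.le)
    rw [hIoi]
    linarith
  · rcases hβ.eq_or_lt with h0 | h0
    · exact Or.inl h0.symm
    right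
    have h1 : Function.leftLim (cdf μ) (sInf S) ≤ 1 - q := by
      refine le_of_tendsto ((cdf μ).mono.tendsto_leftLim (sInf S)) ?_
      filter_upwards [Ioo_mem_nhdsLT h0] with t ht
      by_contra hcon
      exact absurd (csInf_le hbdd ⟨ht.1.le, (not_le.1 hcon).le⟩) (not_le.2 ht.2)
    have h2 := (cdf μ).measure_Ici (tendsto_cdf_atTop μ) (sInf S)
    rw [measure_cdf] at h2
    rw [measureReal_def, h2]
    exact (show q ≤ 1 - Function.leftLim (cdf μ) (sInf S) by linarith).trans
      (Real.le_coe_toNNReal _)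

/-- A nearly optimal price in excess of `β`. -/
lemma exists_reserve (μ : Measure ℝ) (h0 : μ (Iio 0) = 0) (hintg : Integrable id μ) {β : ℝ}
    (hβ : 0 ≤ β) :
    ∃ r, β ≤ r ∧ ∀ t ≥ β, (t - β) * μ.real (Ici t) ≤ 10 / 9 * ((r - β) * μ.real (Ici r)) := by
  have hae : 0 ≤ᵐ[μ] id := by
    refine (ae_iff.2 ?_ : ∀ᵐ t ∂μ, 0 ≤ t)
    simpa [Iio] using h0
  set S : Set ℝ := (fun t => (t - β) * μ.real (Ici t)) '' Ici β with hS
  have hbdd : BddAbove S := by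
    refine ⟨∫ t, id t ∂μ, ?_⟩
    rintro _ ⟨t, -, rfl⟩
    refine le_trans ?_ (mul_meas_ge_le_integral_of_nonneg hae hintg t)
    exact mul_le_mul_of_nonneg_right (by linarith) measureReal_nonneg
  have hmem : ∀ t ≥ β, (t - β) * μ.real (Ici t) ≤ sSup S := fun t ht =>
    le_csSup hbdd (mem_image_of_mem _ ht)
  rcases le_or_gt (sSup S) 0 with hs | hs
  · exact ⟨β, le_rfl, fun t ht => by simpa using (hmem t ht).trans hs⟩
  · obtain ⟨_, ⟨r, hr, rfl⟩, hlt⟩ := exists_lt_of_lt_csSup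
      (nonempty_Ici.image _) (show 9 / 10 * sSup S < sSup S by linarith)
    refine ⟨r, hr, fun t ht => (hmem t ht).trans ?_⟩
    simp only at hlt
    linarith

end quantile

section mechanism

variable {n m : ℕ} {k : Fin m → ℕ}

/-- The fractional relaxation of the matching constraints. -/
lemma fractional_of_mem_convexHull {χ : Fin n → Fin m → ℝ}
    (h : χ ∈ convexHull ℝ {χ : Fin n → Fin m → ℝ |
      ∃ S : Finset (Fin n × Fin m), IsMatching n m k S ∧
        χ = fun i j => if (i, j) ∈ S then 1 else 0}) :
    (∀ i j, 0 ≤ χ i j) ∧ (∀ i, ∑ j, χ i j ≤ 1) ∧ ∀ j, ∑ i, χ i j ≤ k j := by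
  suffices convexHull ℝ _ ⊆ {χ : Fin n → Fin m → ℝ |
      (∀ i j, 0 ≤ χ i j) ∧ (∀ i, ∑ j, χ i j ≤ 1) ∧ ∀ j, ∑ i, χ i j ≤ k j} from this h
  refine convexHull_min ?_ ?_
  · rintro _ ⟨S, hS, rfl⟩
    refine ⟨fun i j => ?_, fun i => ?_, fun j => ?_⟩
    · dsimp only
      split_ifs <;> norm_num
    · rw [Finset.sum_boole]
      refine le_trans (Nat.cast_le.2 ?_) ((Nat.cast_le.2 (hS.1 i)).trans Nat.cast_one.le)
      refine Finset.card_le_card_of_injOn (fun j => (i, j)) ?_ ?_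
      · intro j hj; simpa using hj
      · intro j _ l _ hjl; simpa using hjl
    · rw [Finset.sum_boole]
      refine le_trans (Nat.cast_le.2 ?_) (Nat.cast_le.2 (hS.2 j))
      refine Finset.card_le_card_of_injOn (fun i => (i, j)) ?_ ?_
      · intro i hi; simpa using hi
      · intro i _ l _ hil; simpa using hil
  · rintro χ ⟨h0, h1, h2⟩ ψ ⟨g0, g1, g2⟩ a b ha hb hab
    refine ⟨fun i j => ?_, fun i => ?_, fun j => ?_⟩
    · have := h0 i j
      have := g0 i j
      simp only [Pi.add_apply, Pi.smul_apply, smul_eq_mul]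
      positivity
    · simp only [Pi.add_apply, Pi.smul_apply, smul_eq_mul, Finset.sum_add_distrib,
        ← Finset.mul_sum]
      nlinarith [h1 i, g1 i]
    · simp only [Pi.add_apply, Pi.smul_apply, smul_eq_mul, Finset.sum_add_distrib,
        ← Finset.mul_sum]
      calc a * ∑ i, χ i j + b * ∑ i, ψ i j ≤ a * k j + b * k j := by
            gcongr
            exacts [h2 j, g2 j]
        _ = k j := by rw [← add_mul, hab, one_mul]

variable (F : Fin n → Fin m → Measure ℝ) [∀ i j, IsProbabilityMeasure (F i j)]
  {x : (Fin n → Fin m → ℝ) → Fin n → Fin m → ℝ} {pay : (Fin n → Fin m → ℝ) → Fin n → ℝ}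

lemma ae_nonneg_valMeasure (hF : ∀ i j, F i j (Iio 0) = 0) :
    ∀ᵐ v ∂(valMeasure F), ∀ i j, 0 ≤ v i j := by
  simp only [ae_all_iff]
  intro i j
  refine (measurePreserving_eval_eval F i j).quasiMeasurePreserving.ae (p := fun t => 0 ≤ t) ?_
  rw [ae_iff]
  simpa [Iio] using hF i j

/-- Individual rationality bounds the revenue by the total expected value. -/
lemma IsRandMech.revenue_le (hmech : IsRandMech n m k x pay)
    (hF : ∀ i j, F i j (Iio 0) = 0) (hmean : ∀ i j, Integrable id (F i j)) :
    mechRevenue F pay ≤ ∫ v, ∑ i, ∑ j, v i j ∂(valMeasure F) := by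
  refine integral_mono_of_nonneg (ae_of_all _ fun v => Finset.sum_nonneg fun i _ =>
    hmech.pay_nonneg v i) ?_ ?_
  · refine integrable_finsetSum _ fun i _ => integrable_finsetSum _ fun j _ => ?_
    exact (measurePreserving_eval_eval F i j).integrable_comp_of_integrable (hmean i j)
  · filter_upwards [ae_nonneg_valMeasure F hF] with v hv
    refine Finset.sum_le_sum fun i _ => (sub_nonneg.1 (hmech.ir v hv i)).trans ?_
    obtain ⟨h0, h1, -⟩ := fractional_of_mem_convexHull (hmech.feas v)
    refine Finset.sum_le_sum fun j _ => mul_le_of_le_one_left (hv i j) ?_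
    exact (Finset.single_le_sum (fun l _ => h0 i l) (Finset.mem_univ j)).trans (h1 i)

lemma IsRandMech.integrable_alloc (hmech : IsRandMech n m k x pay) (i : Fin n) (j : Fin m) :
    Integrable (fun v => x v i j) (valMeasure F) := by
  refine Integrable.of_bound (hmech.measX i j).aestronglyMeasurable 1 (ae_of_all _ fun v => ?_)
  obtain ⟨h0, h1, -⟩ := fractional_of_mem_convexHull (hmech.feas v)
  rw [Real.norm_of_nonneg (h0 i j)]
  exact (Finset.single_le_sum (fun l _ => h0 i l) (Finset.mem_univ j)).trans (h1 i)

/-- The ex-ante bound on the revenue of a mechanism. -/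
lemma IsRandMech.revenue_le_exAnte (hmech : IsRandMech n m k x pay)
    (hF : ∀ i j, F i j (Iio 0) = 0) {β R : Fin n → Fin m → ℝ} (hβ : ∀ i j, 0 ≤ β i j)
    (hR : ∀ i j, ∀ t ≥ β i j, (t - β i j) * (F i j).real (Ici t) ≤ R i j) :
    mechRevenue F pay ≤ ∑ i, ((∑ j, β i j * ∫ v, x v i j ∂(valMeasure F)) + ∑ j, 2 * R i j) := by
  have hx0 : ∀ v i j, 0 ≤ x v i j := fun v =>
    (fractional_of_mem_convexHull (hmech.feas v)).1
  have hR0 : ∀ i j, 0 ≤ R i j := fun i j => by simpa using hR i j (β i j) le_rfl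
  have hq0 : ∀ i j, 0 ≤ ∫ v, x v i j ∂(valMeasure F) := fun i j =>
    integral_nonneg fun v => hx0 v i j
  have hagent : ∀ i, ∫⁻ v, ENNReal.ofReal (pay v i) ∂(valMeasure F) ≤ ENNReal.ofReal
      ((∑ j, β i j * ∫ v, x v i j ∂(valMeasure F)) + ∑ j, 2 * R i j) := by
    intro i
    have hresX : ∀ j, ∫⁻ v, ENNReal.ofReal (x v i j) ∂(valMeasure F)
        = ∫⁻ v, ∫⁻ w, ENNReal.ofReal (x (Function.update v i w) i j)
          ∂(Measure.pi fun j => F i j) ∂(valMeasure F) := fun j =>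
      lintegral_pi_resample (fun i => Measure.pi fun j => F i j) i (hmech.measX i j).ennreal_ofReal
    have hupd : Measurable fun q : (Fin n → Fin m → ℝ) × (Fin m → ℝ) =>
        Function.update q.1 i q.2 :=
      (measurePreserving_update (fun i => Measure.pi fun j => F i j) i).measurable
    have hmeas : ∀ j, Measurable fun v : Fin n → Fin m → ℝ =>
        ∫⁻ w, ENNReal.ofReal (x (Function.update v i w) i j) ∂(Measure.pi fun j => F i j) :=
      fun j => Measurable.lintegral_prod_right'
        (f := fun q : (Fin n → Fin m → ℝ) × (Fin m → ℝ) =>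
          ENNReal.ofReal (x (Function.update q.1 i q.2) i j))
        ((hmech.measX i j).comp hupd).ennreal_ofReal
    calc ∫⁻ v, ENNReal.ofReal (pay v i) ∂(valMeasure F)
        = ∫⁻ v, ∫⁻ w, ENNReal.ofReal (pay (Function.update v i w) i)
          ∂(Measure.pi fun j => F i j) ∂(valMeasure F) :=
          lintegral_pi_resample (fun i => Measure.pi fun j => F i j) i
            (hmech.measPay i).ennreal_ofReal
      _ ≤ ∫⁻ v, (∑ j, ENNReal.ofReal (β i j) *
            ∫⁻ w, ENNReal.ofReal (x (Function.update v i w) i j) ∂(Measure.pi fun j => F i j)) +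
            ∑ j, 2 * ENNReal.ofReal (R i j) ∂(valMeasure F) := by
          refine lintegral_mono_ae ?_
          filter_upwards [ae_nonneg_valMeasure F hF] with v hv
          have hpos : ∀ w : Fin m → ℝ, (∀ j, 0 ≤ w j) →
              ∀ l j, 0 ≤ Function.update v i w l j := by
            intro w hw l j
            by_cases h : l = i
            · subst h; simpa using hw j
            · simpa [h] using hv l j
          have hmu : Measurable fun w : Fin m → ℝ => Function.update v i w := measurable_update v
          refine single_agent_le (fun j => F i j) (hF i) (β i) (R i) (hβ i) (hR i)
            (fun w j => x (Function.update v i w) i j) (fun w => pay (Function.update v i w) i)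
            (fun j => (hmech.measX i j).comp hmu) ((hmech.measPay i).comp hmu)
            (fun w j => hx0 _ i j)
            (fun w => (fractional_of_mem_convexHull (hmech.feas _)).2.1 i)
            (fun w hw w' hw' => ?_) fun w hw => ?_
          · simpa using hmech.ic (Function.update v i w) (hpos w hw) i w' hw'
          · simpa using hmech.ir (Function.update v i w) (hpos w hw) i
      _ = ∑ j, ENNReal.ofReal (β i j) * ∫⁻ v, ENNReal.ofReal (x v i j) ∂(valMeasure F)
            + ∑ j, 2 * ENNReal.ofReal (R i j) := by
          rw [lintegral_add_right _ measurable_const, lintegral_const, measure_univ, mul_one,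
            lintegral_finsetSum _ fun j _ => (hmeas j).const_mul _]
          congr 1
          refine Finset.sum_congr rfl fun j _ => ?_
          rw [lintegral_const_mul _ (hmeas j), hresX]
      _ = _ := by
          have h1 : ∀ j, ∫⁻ v, ENNReal.ofReal (x v i j) ∂(valMeasure F)
              = ENNReal.ofReal (∫ v, x v i j ∂(valMeasure F)) := fun j =>
            (ofReal_integral_eq_lintegral_ofReal (hmech.integrable_alloc F i j)
              (ae_of_all _ fun v => hx0 v i j)).symm
          rw [ENNReal.ofReal_add
            (Finset.sum_nonneg fun j _ => mul_nonneg (hβ i j) (hq0 i j))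
            (Finset.sum_nonneg fun j _ => mul_nonneg zero_le_two (hR0 i j)),
            ENNReal.ofReal_sum_of_nonneg fun j _ => mul_nonneg (hβ i j) (hq0 i j),
            ENNReal.ofReal_sum_of_nonneg fun j _ => mul_nonneg zero_le_two (hR0 i j)]
          congr 1
          · exact Finset.sum_congr rfl fun j _ => by rw [h1, ENNReal.ofReal_mul (hβ i j)]
          · exact Finset.sum_congr rfl fun j _ => by
              rw [ENNReal.ofReal_mul zero_le_two, ENNReal.ofReal_ofNat]
  have hterm : ∀ i, 0 ≤ (∑ j, β i j * ∫ v, x v i j ∂(valMeasure F)) + ∑ j, 2 * R i j := fun i =>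
    add_nonneg (Finset.sum_nonneg fun j _ => mul_nonneg (hβ i j) (hq0 i j))
      (Finset.sum_nonneg fun j _ => mul_nonneg zero_le_two (hR0 i j))
  rw [mechRevenue, integral_eq_lintegral_of_nonneg_ae
    (ae_of_all _ fun v => Finset.sum_nonneg fun i _ => hmech.pay_nonneg v i)
    (Finset.measurable_fun_sum _ fun i _ => hmech.measPay i).aestronglyMeasurable]
  refine ENNReal.toReal_le_of_le_ofReal (Finset.sum_nonneg fun i _ => hterm i) ?_
  simp_rw [ENNReal.ofReal_sum_of_nonneg fun i (_ : i ∈ Finset.univ) => hmech.pay_nonneg _ i]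
  rw [lintegral_finsetSum _ fun i _ => (hmech.measPay i).ennreal_ofReal,
    ENNReal.ofReal_sum_of_nonneg fun i _ => hterm i]
  exact Finset.sum_le_sum fun i _ => hagent i

/-- Posted pricing at ex-ante quantiles and at reserves above them. -/
lemma exAnte_le_of_forall_isDeterministic (hk : ∀ j, 1 ≤ k j) {Q β r : Fin n → Fin m → ℝ} {D : ℝ}
    (hD : ∀ x' pay', IsRandMech n m k x' pay' → IsDeterministic n m k x' →
      mechRevenue F pay' ≤ D)
    (hQ : ∀ i j, 0 < Q i j) (hQagent : ∀ i, ∑ j, Q i j ≤ 5 / 4)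
    (hQitem : ∀ j, ∑ i, Q i j ≤ 5 / 4 * k j) (hβ : ∀ i j, 0 ≤ β i j)
    (hβIoi : ∀ i j, (F i j).real (Ioi (β i j)) ≤ Q i j)
    (hβIci : ∀ i j, β i j = 0 ∨ Q i j ≤ (F i j).real (Ici (β i j))) (hr : ∀ i j, β i j ≤ r i j) :
    ∑ i, ∑ j, β i j * Q i j ≤ 10 * D ∧
      ∑ i, ∑ j, (r i j - β i j) * (F i j).real (Ici (r i j)) ≤ 10 * D := by
  have key : ∀ (p s c : Fin n → Fin m → ℝ), (∀ i j, 0 ≤ p i j) → (∀ i j, 0 ≤ s i j) →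
      (∀ i j, s i j ≤ 1) → (∀ i j, s i j * (F i j).real (Ici (p i j)) ≤ 2 / 5 * Q i j) →
      (∀ i j, 2 / 5 * c i j ≤ p i j * (s i j * (F i j).real (Ici (p i j)))) →
      ∑ i, ∑ j, c i j ≤ 10 * D := by
    intro p s c hp hs0 hs1 hle hc
    obtain ⟨x', pay', hx', hdet, hrev⟩ := exists_isDeterministic_quarter_le hk F hp hs0 hs1
      (fun i => by
        have := Finset.sum_le_sum fun j (_ : j ∈ Finset.univ) => hle i j
        rw [← Finset.mul_sum] at this
        linarith [hQagent i])
      (fun j => by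
        have := Finset.sum_le_sum fun i (_ : i ∈ Finset.univ) => hle i j
        rw [← Finset.mul_sum] at this
        linarith [hQitem j])
    have h1 := hrev.trans (hD x' pay' hx' hdet)
    have h2 := Finset.sum_le_sum fun i (_ : i ∈ Finset.univ) =>
      Finset.sum_le_sum fun j (_ : j ∈ Finset.univ) => hc i j
    simp only [← Finset.mul_sum] at h2
    linarith
  constructor
  · refine key β (fun i j => if β i j = 0 then 0 else 2 / 5 * (Q i j / (F i j).real (Ici (β i j))))
      _ hβ (fun i j => ?_) (fun i j => ?_) (fun i j => ?_) fun i j => ?_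
    · have := (hQ i j).le
      split_ifs
      · rfl
      · positivity
    all_goals
      have hq := hQ i j
      split_ifs with h
    · norm_num
    · have := (div_le_one (hq.trans_le ((hβIci i j).resolve_left h))).2 ((hβIci i j).resolve_left h)
      linarith
    · linarith
    · have := (hq.trans_le ((hβIci i j).resolve_left h)).ne'
      rw [mul_assoc, div_mul_cancel₀ _ this]
    · simp [h]
    · have := (hq.trans_le ((hβIci i j).resolve_left h)).ne'
      rw [mul_assoc (2 / 5 : ℝ), div_mul_cancel₀ _ this]
      linarith
  · refine key r (fun i j => if r i j = β i j then 0 else 2 / 5) _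
      (fun i j => (hβ i j).trans (hr i j)) (fun i j => ?_) (fun i j => ?_) (fun i j => ?_)
      fun i j => ?_
    · split_ifs <;> norm_num
    · split_ifs <;> norm_num
    all_goals
      have hq := hQ i j
      split_ifs with h
    · linarith
    · have hlt : β i j < r i j := lt_of_le_of_ne (hr i j) (Ne.symm h)
      have : (F i j).real (Ici (r i j)) ≤ (F i j).real (Ioi (β i j)) :=
        measureReal_mono (Ici_subset_Ioi.2 hlt)
      linarith [hβIoi i j]
    · simp [h]
    · nlinarith [mul_nonneg (hβ i j) (measureReal_nonneg (μ := F i j) (s := Ici (r i j)))]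

end mechanism

end

/-- For `n` unit-demand agents, `m` items with capacities
`k j ≥ 1`, and independent values `v i j ∼ F i j` (Borel distributions on
`ℝ≥0` with finite mean), the expected revenue of every IC, IR randomized
mechanism for the multi-agent unit-demand instance is at most `33.75` times
the supremum of expected revenue over IC, IR deterministic mechanisms for the
instance. -/
theorem randMech_le_detSup
    {n m : ℕ} (k : Fin m → ℕ) (hk : ∀ j, 1 ≤ k j)
    (F : Fin n → Fin m → Measure ℝ) [∀ i j, IsProbabilityMeasure (F i j)]
    (hF_nonneg : ∀ i j, F i j (Set.Iio 0) = 0)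
    (hF_mean : ∀ i j, Integrable id (F i j))
    (x : (Fin n → Fin m → ℝ) → Fin n → Fin m → ℝ)
    (pay : (Fin n → Fin m → ℝ) → Fin n → ℝ)
    (hmech : IsRandMech n m k x pay) :
    mechRevenue F pay ≤
      33.75 * sSup {r : ℝ | ∃ (x' : (Fin n → Fin m → ℝ) → Fin n → Fin m → ℝ)
        (pay' : (Fin n → Fin m → ℝ) → Fin n → ℝ),
        IsRandMech n m k x' pay' ∧ IsDeterministic n m k x' ∧
        r = mechRevenue F pay'} := by
  set D := sSup {r : ℝ | ∃ (x' : (Fin n → Fin m → ℝ) → Fin n → Fin m → ℝ)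
    (pay' : (Fin n → Fin m → ℝ) → Fin n → ℝ),
    IsRandMech n m k x' pay' ∧ IsDeterministic n m k x' ∧ r = mechRevenue F pay'} with hDdef
  have hD : ∀ x' pay', IsRandMech n m k x' pay' → IsDeterministic n m k x' →
      mechRevenue F pay' ≤ D := by
    intro x' pay' hx' hdet
    refine le_csSup ⟨∫ v, ∑ i, ∑ j, v i j ∂(valMeasure F), ?_⟩ ⟨x', pay', hx', hdet, rfl⟩
    rintro _ ⟨x'', pay'', hx'', -, rfl⟩
    exact hx''.revenue_le F hF_nonneg hF_mean
  have hfrac := fun v => fractional_of_mem_convexHull (hmech.feas v)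
  set q : Fin n → Fin m → ℝ := fun i j => ∫ v, x v i j ∂(valMeasure F) with hq
  have hq0 : ∀ i j, 0 ≤ q i j := fun i j => integral_nonneg fun v => (hfrac v).1 i j
  have hintg := hmech.integrable_alloc F
  have hqagent : ∀ i, ∑ j, q i j ≤ 1 := by
    intro i
    rw [← integral_finsetSum _ fun j _ => hintg i j]
    refine (integral_mono (integrable_finsetSum _ fun j _ => hintg i j) (integrable_const 1)
      fun v => (hfrac v).2.1 i).trans (by simp)
  have hqitem : ∀ j, ∑ i, q i j ≤ k j := by
    intro j
    rw [← integral_finsetSum _ fun i _ => hintg i j]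
    refine (integral_mono (integrable_finsetSum _ fun i _ => hintg i j)
      (integrable_const (k j : ℝ)) fun v => (hfrac v).2.2 j).trans (by simp)
  set δ : ℝ := 1 / (4 * (n + m + 1)) with hδ
  have hδ0 : 0 < δ := by positivity
  have hδ1 : 4 * ((n + m + 1) * δ) = 1 := by
    rw [hδ]
    field_simp
  have hδn : 0 ≤ n * δ := by positivity
  have hδm : 0 ≤ m * δ := by positivity
  have hQ : ∀ i j, 0 < q i j + δ := fun i j => by linarith [hq0 i j]
  choose β hβ hβIoi hβIci using fun i j => exists_quantile (F i j) (hQ i j)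
  choose r hr hrR using fun i j => exists_reserve (F i j) (hF_nonneg i j) (hF_mean i j) (hβ i j)
  obtain ⟨hA, hB⟩ := exAnte_le_of_forall_isDeterministic F hk hD hQ
    (fun i => by
      rw [Finset.sum_add_distrib, Finset.sum_const, Finset.card_univ, Fintype.card_fin,
        nsmul_eq_mul]
      linarith [hqagent i])
    (fun j => by
      have hkj : (1 : ℝ) ≤ k j := by exact_mod_cast hk j
      rw [Finset.sum_add_distrib, Finset.sum_const, Finset.card_univ, Fintype.card_fin,
        nsmul_eq_mul]
      linarith [hqitem j])
    hβ hβIoi hβIci hr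
  have hrev := hmech.revenue_le_exAnte F hF_nonneg hβ hrR
  have hle : ∑ i, ∑ j, β i j * q i j ≤ ∑ i, ∑ j, β i j * (q i j + δ) :=
    Finset.sum_le_sum fun i _ => Finset.sum_le_sum fun j _ =>
      mul_le_mul_of_nonneg_left (by linarith) (hβ i j)
  have hB0 : 0 ≤ ∑ i, ∑ j, (r i j - β i j) * (F i j).real (Set.Ici (r i j)) :=
    Finset.sum_nonneg fun i _ => Finset.sum_nonneg fun j _ =>
      mul_nonneg (sub_nonneg.2 (hr i j)) measureReal_nonneg
  simp only [Finset.sum_add_distrib, ← Finset.mul_sum] at hrev hle hA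
  linarith
end
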